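/- arXiv:1603.02295 — 2 statements merged into one kernel-verified Lean document; each statement's English description precedes it below -/
import Mathlib

section
/- Let Ω ⊆ ℝ³ be a bounded open set with C¹ boundary. Then |Ω|^{3/4} ≤ (3/(2π))^{1/4} · P_ℍ(Ω), where P_ℍ(Ω) is the horizontal perimeter of Ω. -/
open MeasureTheory Real Set

noncomputable section

/-- The underlying space of the Heisenberg group ℍ¹: ℝ³ with coordinates (x, y, t). -/
abbrev H1 : Type := ℝ × ℝ × ℝ

/-- The Koranyi norm ρ(x,y,t) = ((x²+y²)² + t²)^{1/4}. -/
def ρH (η : H1) : ℝ := ((η.1 ^ 2 + η.2.1 ^ 2) ^ 2 + η.2.2 ^ 2) ^ ((1 : ℝ) / 4)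

/-- The Heisenberg group law: η∘ξ = (x+x₀, y+y₀, t+t₀+2(x₀y − x y₀)). -/
def hmul (η ξ : H1) : H1 :=
  (η.1 + ξ.1, η.2.1 + ξ.2.1, η.2.2 + ξ.2.2 + 2 * (ξ.1 * η.2.1 - η.1 * ξ.2.1))

/-- The Heisenberg group inverse: ξ⁻¹ = (−x₀,−y₀,−t₀). -/
def hinv (ξ : H1) : H1 := (-ξ.1, -ξ.2.1, -ξ.2.2)

/-- The Koranyi distance d(ξ,η) = ρ(ξ⁻¹∘η). -/
def kd (ξ η : H1) : ℝ := ρH (hmul (hinv ξ) η)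

/-- The Koranyi ball B(ξ,r) = {η : d(ξ,η) < r}. -/
def kball (ξ : H1) (r : ℝ) : Set H1 := {η | kd ξ η < r}

/-- Horizontal derivative Xu = ∂u/∂x + 2y·∂u/∂t, as the derivative along (1,0,2y). -/
def Xd (u : H1 → ℝ) (η : H1) : ℝ := fderiv ℝ u η (1, 0, 2 * η.2.1)

/-- Horizontal derivative Yu = ∂u/∂y − 2x·∂u/∂t, as the derivative along (0,1,−2x). -/
def Yd (u : H1 → ℝ) (η : H1) : ℝ := fderiv ℝ u η (0, 1, -2 * η.1)

/-- The Kohn-Laplacian Δ_ℍ u = X(Xu) + Y(Yu). -/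
def kohn (u : H1 → ℝ) (η : H1) : ℝ := Xd (Xd u) η + Yd (Yd u) η

/-- The fundamental solution with pole ξ: Γ_ξ(η) = 1/(8π d(ξ,η)²). -/
def Γξ (ξ η : H1) : ℝ := 1 / (8 * π * kd ξ η ^ 2)

/-- A set A satisfies the uniform exterior ball property if there exists r₀ > 0 such that
for every ζ ∈ ∂A and every r ∈ (0,r₀] there exists η with B(η,r) ∩ A = ∅ and ζ ∈ ∂B(η,r). -/
def uebp (A : Set H1) : Prop :=
  ∃ r₀ > (0 : ℝ), ∀ ζ ∈ frontier A, ∀ r : ℝ, 0 < r → r ≤ r₀ →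
    ∃ η : H1, kball η r ∩ A = ∅ ∧ ζ ∈ frontier (kball η r)

/-- Ω has C¹ boundary: it is the sublevel set of a C¹ defining function with
nonvanishing gradient on the boundary. -/
def c1Bdry (Ω : Set H1) : Prop :=
  ∃ f : H1 → ℝ, ContDiff ℝ 1 f ∧ Ω = {x | f x < 0} ∧
    frontier Ω = {x | f x = 0} ∧ ∀ x ∈ frontier Ω, fderiv ℝ f x ≠ 0

/-- Ω has smooth boundary: it is the sublevel set of a smooth defining function with
nonvanishing gradient on the boundary. -/
def smoothBdry (Ω : Set H1) : Prop :=
  ∃ f : H1 → ℝ, ContDiff ℝ (⊤ : ℕ∞) f ∧ Ω = {x | f x < 0} ∧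
    frontier Ω = {x | f x = 0} ∧ ∀ x ∈ frontier Ω, fderiv ℝ f x ≠ 0

/-- The horizontal perimeter of Ω:
P_ℍ(Ω) = sup { ∫_Ω (Xa + Yb) : a,b of class C¹ with a²+b² ≤ 1 }. -/
def horizPerim (Ω : Set H1) : ℝ :=
  sSup { p : ℝ | ∃ a b : H1 → ℝ, ContDiff ℝ 1 a ∧ ContDiff ℝ 1 b ∧
    (∀ η, a η ^ 2 + b η ^ 2 ≤ 1) ∧ p = ∫ η in Ω, (Xd a η + Yd b η) }

/-- The first Dirichlet eigenvalue of the Kohn-Laplacian on Ω, via the Rayleigh quotient. -/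
def lam1 (Ω : Set H1) : ℝ :=
  sInf { q : ℝ | ∃ v : H1 → ℝ, ContDiff ℝ (⊤ : ℕ∞) v ∧ HasCompactSupport v ∧ tsupport v ⊆ Ω ∧
    v ≠ 0 ∧ q = (∫ η in Ω, ((Xd v η) ^ 2 + (Yd v η) ^ 2)) / (∫ η in Ω, (v η) ^ 2) }

/-- The Bessel function of the first kind of order 1,
J₁(l) = (l/2)·Σ_{k=0}^∞ ((−1)^k/(k!·(k+1)!))·(l/2)^{2k}. -/
def J1 (l : ℝ) : ℝ :=
  (l / 2) * ∑' k : ℕ,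
    ((-1 : ℝ) ^ k / ((Nat.factorial k : ℝ) * (Nat.factorial (k + 1) : ℝ))) * (l / 2) ^ (2 * k)
instance isAddHaarMeasure_volume_real_prod : (volume : Measure (ℝ × ℝ)).IsAddHaarMeasure :=
  Measure.prod.instIsAddHaarMeasure _ _

instance isAddHaarMeasure_volume_H1 : (volume : Measure H1).IsAddHaarMeasure :=
  Measure.prod.instIsAddHaarMeasure _ _

/-- The integral of the horizontal derivative `Xd` of a compactly supported function vanishes. -/
lemma integral_Xd_eq_zero {u : H1 → ℝ} (hu : ContDiff ℝ 1 u) (hc : HasCompactSupport u) :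
    ∫ η, Xd u η = 0 := by
  have hd : ∀ v : H1, Continuous fun η => fderiv ℝ u η v := fun v =>
    (hu.continuous_fderiv one_ne_zero).clm_apply continuous_const
  have hdc : ∀ v : H1, HasCompactSupport fun η => fderiv ℝ u η v := fun v => hc.fderiv_apply ℝ v
  have huc := hu.continuous
  have h1 : ∫ η, (1 : ℝ) * fderiv ℝ u η (1, 0, 0) = 0 := by
    rw [integral_mul_fderiv_eq_neg_fderiv_mul_of_integrable]
    · simp
    · simp
    · simpa using (hd _).integrable_of_hasCompactSupport (hdc _)
    · simpa using huc.integrable_of_hasCompactSupport hc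
    · fun_prop
    · intro x _; exact (hu.differentiable one_ne_zero) x
  have hlin : ∀ η : H1, fderiv ℝ (fun η : H1 => 2 * η.2.1) η (0, 0, 1) = 0 := by
    intro η
    have : HasFDerivAt (fun η : H1 => 2 * η.2.1)
        ((2 : ℝ) • ((ContinuousLinearMap.fst ℝ ℝ ℝ).comp (ContinuousLinearMap.snd ℝ ℝ (ℝ × ℝ)))) η :=
      (((ContinuousLinearMap.fst ℝ ℝ ℝ).comp
        (ContinuousLinearMap.snd ℝ ℝ (ℝ × ℝ))).hasFDerivAt).const_mul 2
    rw [this.fderiv]; simp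
  have h2 : ∫ η : H1, (2 * η.2.1) * fderiv ℝ u η (0, 0, 1) = 0 := by
    rw [integral_mul_fderiv_eq_neg_fderiv_mul_of_integrable]
    · simp [hlin]
    · simp [hlin]
    · exact ((by fun_prop : Continuous fun η : H1 => 2 * η.2.1).mul
        (hd _)).integrable_of_hasCompactSupport ((hdc _).mul_left)
    · exact ((by fun_prop : Continuous fun η : H1 => 2 * η.2.1).mul
        huc).integrable_of_hasCompactSupport (hc.mul_left)
    · fun_prop
    · intro x _; exact (hu.differentiable one_ne_zero) x
  have key : ∀ η, Xd u η = (1 : ℝ) * fderiv ℝ u η (1, 0, 0)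
      + (2 * η.2.1) * fderiv ℝ u η (0, 0, 1) := by
    intro η
    rw [Xd, one_mul, ← smul_eq_mul (2 * η.2.1), ← map_smul, ← map_add]
    simp
  simp_rw [key]
  rw [integral_add, h1, h2, add_zero]
  · simpa using (hd _).integrable_of_hasCompactSupport (hdc _)
  · exact ((by fun_prop : Continuous fun η : H1 => 2 * η.2.1).mul
        (hd _)).integrable_of_hasCompactSupport ((hdc _).mul_left)

/-- The integral of the horizontal derivative `Yd` of a compactly supported function vanishes. -/
lemma integral_Yd_eq_zero {u : H1 → ℝ} (hu : ContDiff ℝ 1 u) (hc : HasCompactSupport u) :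
    ∫ η, Yd u η = 0 := by
  have hd : ∀ v : H1, Continuous fun η => fderiv ℝ u η v := fun v =>
    (hu.continuous_fderiv one_ne_zero).clm_apply continuous_const
  have hdc : ∀ v : H1, HasCompactSupport fun η => fderiv ℝ u η v := fun v => hc.fderiv_apply ℝ v
  have huc := hu.continuous
  have h1 : ∫ η, (1 : ℝ) * fderiv ℝ u η (0, 1, 0) = 0 := by
    rw [integral_mul_fderiv_eq_neg_fderiv_mul_of_integrable]
    · simp
    · simp
    · simpa using (hd _).integrable_of_hasCompactSupport (hdc _)
    · simpa using huc.integrable_of_hasCompactSupport hc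
    · fun_prop
    · intro x _; exact (hu.differentiable one_ne_zero) x
  have hlin : ∀ η : H1, fderiv ℝ (fun η : H1 => -2 * η.1) η (0, 0, 1) = 0 := by
    intro η
    have : HasFDerivAt (fun η : H1 => -2 * η.1)
        ((-2 : ℝ) • (ContinuousLinearMap.fst ℝ ℝ (ℝ × ℝ))) η :=
      (ContinuousLinearMap.fst ℝ ℝ (ℝ × ℝ)).hasFDerivAt.const_mul (-2)
    rw [this.fderiv]; simp
  have h2 : ∫ η : H1, (-2 * η.1) * fderiv ℝ u η (0, 0, 1) = 0 := by
    rw [integral_mul_fderiv_eq_neg_fderiv_mul_of_integrable]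
    · simp only [hlin]; simp
    · simp only [hlin]; simp
    · exact ((by fun_prop : Continuous fun η : H1 => -2 * η.1).mul
        (hd _)).integrable_of_hasCompactSupport ((hdc _).mul_left)
    · exact ((by fun_prop : Continuous fun η : H1 => -2 * η.1).mul
        huc).integrable_of_hasCompactSupport (hc.mul_left)
    · fun_prop
    · intro x _; exact (hu.differentiable one_ne_zero) x
  have key : ∀ η, Yd u η = (1 : ℝ) * fderiv ℝ u η (0, 1, 0)
      + (-2 * η.1) * fderiv ℝ u η (0, 0, 1) := by
    intro η
    rw [Yd, one_mul, ← smul_eq_mul (-2 * η.1), ← map_smul, ← map_add]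
    simp
  simp_rw [key]
  rw [integral_add, h1, h2, add_zero]
  · simpa using (hd _).integrable_of_hasCompactSupport (hdc _)
  · exact ((by fun_prop : Continuous fun η : H1 => -2 * η.1).mul
        (hd _)).integrable_of_hasCompactSupport ((hdc _).mul_left)

/-- Near a regular point of `f`, the layer `-ε < f < 0` has volume `O(ε)`. -/
lemma exists_nhds_volume_layer_le {f : H1 → ℝ} (hf : ContDiff ℝ 1 f) {p : H1}
    (hp : fderiv ℝ f p ≠ 0) :
    ∃ U ∈ nhds p, ∃ C : ENNReal, C ≠ ⊤ ∧ ∀ ε > 0,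
      volume (U ∩ {x | -ε < f x ∧ f x < 0}) ≤ C * ENNReal.ofReal ε := by
  obtain ⟨v, hv⟩ : ∃ v, fderiv ℝ f p v = 2 := by
    obtain ⟨w, hw⟩ : ∃ w, fderiv ℝ f p w ≠ 0 := by
      by_contra! h; exact hp (ContinuousLinearMap.ext h)
    exact ⟨(2 / fderiv ℝ f p w) • w, by simp [hw]⟩
  have hcont : Continuous fun x => fderiv ℝ f x v :=
    (hf.continuous_fderiv one_ne_zero).clm_apply continuous_const
  obtain ⟨δ, hδ, hball⟩ := Metric.mem_nhds_iff.1
    (hcont.continuousAt.preimage_mem_nhds (Ioi_mem_nhds (a := 1) (by rw [hv]; norm_num)))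
  refine ⟨Metric.ball p δ, Metric.ball_mem_nhds p hδ,
    volume (Metric.closedBall p (δ + ‖v‖)), measure_closedBall_lt_top.ne, fun ε hε => ?_⟩
  set S := Metric.ball p δ ∩ {x | -ε < f x ∧ f x < 0} with hS
  have hSo : IsOpen S := by
    have := hf.continuous
    exact Metric.isOpen_ball.inter
      ((isOpen_lt continuous_const this).inter (isOpen_lt this continuous_const))
  have hline : ∀ x : H1, volume {s : ℝ | x + s • v ∈ S} ≤ ENNReal.ofReal ε := by
    intro x
    refine (Real.volume_le_diam _).trans (Metric.ediam_le fun s hs r hr => ?_)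
    rw [edist_dist, Real.dist_eq]
    refine ENNReal.ofReal_le_ofReal ?_
    wlog hsr : s ≤ r generalizing s r
    · rw [abs_sub_comm]; exact this r hr s hs (le_of_not_ge hsr)
    rw [abs_sub_comm, abs_of_nonneg (by linarith)]
    have hder : ∀ τ : ℝ, HasDerivAt (fun τ : ℝ => f (x + τ • v)) (fderiv ℝ f (x + τ • v) v) τ := by
      intro τ
      refine ((hf.differentiable one_ne_zero) _).hasFDerivAt.comp_hasDerivAt τ ?_
      simpa using ((hasDerivAt_id τ).smul_const v).const_add x
    have hmem : ∀ τ ∈ Icc s r, x + τ • v ∈ Metric.ball p δ := by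
      intro τ hτ
      have hconv : Convex ℝ ((fun τ : ℝ => x + τ • v) ⁻¹' Metric.ball p δ) := by
        have := (convex_ball p δ).affine_preimage
          (AffineMap.lineMap x (x + v) : ℝ →ᵃ[ℝ] H1)
        have e : (fun τ : ℝ => x + τ • v) = AffineMap.lineMap x (x + v) := by
          ext1 τ; simp [AffineMap.lineMap_apply, add_comm]
        rwa [e]
      exact hconv.ordConnected.out hs.1 hr.1 hτ
    have := (convex_Icc s r).mul_sub_le_image_sub_of_le_deriv (C := 1)
      (f := fun τ : ℝ => f (x + τ • v))
      (fun τ _ => (hder τ).continuousAt.continuousWithinAt)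
      (fun τ _ => (hder τ).differentiableAt.differentiableWithinAt)
      (fun τ hτ => by
        rw [(hder τ).deriv]
        exact (hball (hmem τ (interior_subset hτ))).le)
      s ⟨le_rfl, hsr⟩ r ⟨hsr, le_rfl⟩ hsr
    have h1 := hs.2.1
    have h2 := hr.2.2
    linarith
  have hmeas : MeasurableSet {q : ℝ × H1 | q.2 + q.1 • v ∈ S} :=
    (hSo.preimage (f := fun q : ℝ × H1 => q.2 + q.1 • v) (by fun_prop)).measurableSet
  have hswap : ∫⁻ s in Icc (0 : ℝ) 1, volume {x : H1 | x + s • v ∈ S}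
      = ∫⁻ x : H1, volume.restrict (Icc (0 : ℝ) 1) {s : ℝ | x + s • v ∈ S} := by
    have e1 := Measure.prod_apply (μ := volume.restrict (Icc (0 : ℝ) 1)) (ν := (volume : Measure H1))
      hmeas
    have e2 := Measure.prod_apply_symm (μ := volume.restrict (Icc (0 : ℝ) 1))
      (ν := (volume : Measure H1)) hmeas
    exact e1.symm.trans e2
  have hleft : ∫⁻ s in Icc (0 : ℝ) 1, volume {x : H1 | x + s • v ∈ S} = volume S := by
    have : ∀ s : ℝ, volume {x : H1 | x + s • v ∈ S} = volume S := fun s =>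
      measure_preimage_add_right volume (s • v) S
    simp [this]
  rw [← hleft, hswap]
  calc ∫⁻ x : H1, volume.restrict (Icc (0 : ℝ) 1) {s : ℝ | x + s • v ∈ S}
      ≤ ∫⁻ x : H1, (Metric.closedBall p (δ + ‖v‖)).indicator (fun _ => ENNReal.ofReal ε) x := by
        refine lintegral_mono fun x => ?_
        by_cases hx : x ∈ Metric.closedBall p (δ + ‖v‖)
        · rw [indicator_of_mem hx]
          exact (Measure.restrict_apply_le _ _).trans (hline x)
        · rw [indicator_of_notMem hx, nonpos_iff_eq_zero,
            Measure.restrict_apply' measurableSet_Icc]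
          convert measure_empty (μ := (volume : Measure ℝ))
          rw [eq_empty_iff_forall_notMem]
          rintro s ⟨hs, hs0, hs1⟩
          apply hx
          have h1 : dist (x + s • v) p < δ := hs.1
          have h2 : dist x (x + s • v) ≤ ‖v‖ := by
            rw [dist_eq_norm]
            simp only [sub_add_cancel_left, norm_neg, norm_smul, Real.norm_eq_abs]
            rw [abs_of_nonneg hs0]
            nlinarith [norm_nonneg v]
          have := dist_triangle x (x + s • v) p
          rw [Metric.mem_closedBall]; linarith
    _ = volume (Metric.closedBall p (δ + ‖v‖)) * ENNReal.ofReal ε := by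
        rw [lintegral_indicator_const Metric.isClosed_closedBall.measurableSet, mul_comm]

/-- The inner layer `-ε < f < 0` of a bounded domain `{f < 0}` with regular boundary has volume
`O(ε)` as `ε → 0`. -/
lemma exists_volume_layer_le {Ω : Set H1} (hΩb : Bornology.IsBounded Ω) {f : H1 → ℝ}
    (hf : ContDiff ℝ 1 f) (hΩ : Ω = {x | f x < 0})
    (hreg : ∀ x ∈ frontier Ω, fderiv ℝ f x ≠ 0) :
    ∃ C : ENNReal, C ≠ ⊤ ∧ ∃ ε₀ > 0, ∀ ε > 0, ε < ε₀ →
      volume {x | -ε < f x ∧ f x < 0} ≤ C * ENNReal.ofReal ε := by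
  have hcl : IsCompact (closure Ω) := hΩb.isCompact_closure
  have hfc : IsCompact (frontier Ω) := hcl.of_isClosed_subset isClosed_frontier
    frontier_subset_closure
  obtain ⟨W, hWo, hW, C, hC, hbound⟩ : ∃ W : Set H1, IsOpen W ∧ frontier Ω ⊆ W ∧
      ∃ C : ENNReal, C ≠ ⊤ ∧ ∀ ε > 0,
        volume (W ∩ {x | -ε < f x ∧ f x < 0}) ≤ C * ENNReal.ofReal ε := by
    refine hfc.induction_on (p := fun K => ∃ W : Set H1, IsOpen W ∧ K ⊆ W ∧
      ∃ C : ENNReal, C ≠ ⊤ ∧ ∀ ε > 0,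
        volume (W ∩ {x | -ε < f x ∧ f x < 0}) ≤ C * ENNReal.ofReal ε) ?_ ?_ ?_ ?_
    · exact ⟨∅, isOpen_empty, subset_rfl, 0, by simp, by simp⟩
    · rintro s t hst ⟨W, hWo, hW, h⟩
      exact ⟨W, hWo, hst.trans hW, h⟩
    · rintro s t ⟨W, hWo, hW, C, hC, h⟩ ⟨W', hWo', hW', C', hC', h'⟩
      refine ⟨W ∪ W', hWo.union hWo', union_subset_union hW hW', C + C',
        ENNReal.add_ne_top.2 ⟨hC, hC'⟩, fun ε hε => ?_⟩
      rw [union_inter_distrib_right, add_mul]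
      exact (measure_union_le _ _).trans (add_le_add (h ε hε) (h' ε hε))
    · intro x hx
      obtain ⟨U, hU, C, hC, h⟩ := exists_nhds_volume_layer_le hf (hreg x hx)
      obtain ⟨V, hVU, hVo, hxV⟩ := mem_nhds_iff.1 hU
      exact ⟨V, mem_nhdsWithin_of_mem_nhds (hVo.mem_nhds hxV), V, hVo, subset_rfl, C, hC,
        fun ε hε => (measure_mono (inter_subset_inter_left _ hVU)).trans (h ε hε)⟩
  have hneg : ∀ x ∈ closure Ω \ W, f x < 0 := by
    intro x hx
    have h0 : x ∉ frontier Ω := fun h => hx.2 (hW h)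
    have : x ∈ Ω := by
      by_contra h
      exact h0 ⟨hx.1, fun h' => h (interior_subset h')⟩
    rwa [hΩ] at this
  obtain ⟨ε₀, hε₀, hle⟩ : ∃ ε₀ > 0, ∀ x ∈ closure Ω \ W, f x ≤ -ε₀ := by
    rcases (closure Ω \ W).eq_empty_or_nonempty with h | h
    · exact ⟨1, one_pos, by simp [h]⟩
    · obtain ⟨x, hx, hmax⟩ := (hcl.diff hWo).exists_isMaxOn h hf.continuous.continuousOn
      exact ⟨-f x, by linarith [hneg x hx], fun y hy => by simpa using hmax hy⟩
  refine ⟨C, hC, ε₀, hε₀, fun ε hε hlt => (measure_mono fun x hx => ?_).trans (hbound ε hε)⟩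
  refine ⟨?_, hx⟩
  by_contra hxW
  have hxΩ : x ∈ Ω := by rw [hΩ]; exact hx.2
  linarith [hle x ⟨subset_closure hxΩ, hxW⟩, hx.1]

/-- A bound for the derivative of the smooth transition function. -/
lemma exists_abs_deriv_smoothTransition_le :
    ∃ L : ℝ, 0 ≤ L ∧ ∀ x, |deriv Real.smoothTransition x| ≤ L := by
  have hc : Continuous (deriv Real.smoothTransition) :=
    (Real.smoothTransition.contDiff (n := 1)).continuous_deriv le_rfl
  obtain ⟨L, hL⟩ := (isCompact_Icc (a := (0 : ℝ)) (b := 1)).exists_bound_of_continuousOn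
    hc.continuousOn
  have hL0 : 0 ≤ L := (norm_nonneg _).trans (hL 0 (by simp))
  refine ⟨L, hL0, fun x => ?_⟩
  by_cases hx : x ∈ Icc (0 : ℝ) 1
  · exact hL x hx
  · have : deriv Real.smoothTransition x = 0 := by
      rw [mem_Icc, not_and_or, not_le, not_le] at hx
      rcases hx with hx | hx
      · have : Real.smoothTransition =ᶠ[nhds x] fun _ => 0 := by
          filter_upwards [Iio_mem_nhds hx] with y hy
          exact Real.smoothTransition.zero_of_nonpos (le_of_lt hy)
        rw [this.deriv_eq]; simp
      · have : Real.smoothTransition =ᶠ[nhds x] fun _ => 1 := by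
          filter_upwards [Ioi_mem_nhds hx] with y hy
          exact Real.smoothTransition.one_of_one_le (le_of_lt hy)
        rw [this.deriv_eq]; simp
    rw [this, abs_zero]; exact hL0

lemma continuous_Xd {u : H1 → ℝ} (hu : ContDiff ℝ 1 u) : Continuous (Xd u) :=
  (hu.continuous_fderiv one_ne_zero).clm_apply (by fun_prop)

lemma continuous_Yd {u : H1 → ℝ} (hu : ContDiff ℝ 1 u) : Continuous (Yd u) :=
  (hu.continuous_fderiv one_ne_zero).clm_apply (by fun_prop)

lemma Xd_mul {u v : H1 → ℝ} (hu : ContDiff ℝ 1 u) (hv : ContDiff ℝ 1 v) (η : H1) :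
    Xd (fun η => u η * v η) η = u η * Xd v η + v η * Xd u η := by
  unfold Xd
  rw [fderiv_fun_mul (hu.differentiable one_ne_zero η) (hv.differentiable one_ne_zero η)]
  simp

lemma Yd_mul {u v : H1 → ℝ} (hu : ContDiff ℝ 1 u) (hv : ContDiff ℝ 1 v) (η : H1) :
    Yd (fun η => u η * v η) η = u η * Yd v η + v η * Yd u η := by
  unfold Yd
  rw [fderiv_fun_mul (hu.differentiable one_ne_zero η) (hv.differentiable one_ne_zero η)]
  simp

/-- Integration by parts for the horizontal divergence. -/
lemma integral_mul_horizontal_div {g a b : H1 → ℝ} (hg : ContDiff ℝ 1 g)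
    (hc : HasCompactSupport g) (ha : ContDiff ℝ 1 a) (hb : ContDiff ℝ 1 b) :
    ∫ η, g η * (Xd a η + Yd b η) = -∫ η, (a η * Xd g η + b η * Yd g η) := by
  have hX := integral_Xd_eq_zero (hg.mul ha) hc.mul_right
  have hY := integral_Yd_eq_zero (hg.mul hb) hc.mul_right
  have hcX : HasCompactSupport (Xd g) := by
    refine (hc.fderiv ℝ).mono fun η hη => ?_
    contrapose! hη
    simp only [Function.mem_support, not_not] at hη ⊢
    simp [Xd, hη]
  have hcY : HasCompactSupport (Yd g) := by
    refine (hc.fderiv ℝ).mono fun η hη => ?_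
    contrapose! hη
    simp only [Function.mem_support, not_not] at hη ⊢
    simp [Yd, hη]
  have i1 : Integrable fun η => g η * Xd a η :=
    (hg.continuous.mul (continuous_Xd ha)).integrable_of_hasCompactSupport hc.mul_right
  have i2 : Integrable fun η => g η * Yd b η :=
    (hg.continuous.mul (continuous_Yd hb)).integrable_of_hasCompactSupport hc.mul_right
  have i3 : Integrable fun η => a η * Xd g η :=
    (ha.continuous.mul (continuous_Xd hg)).integrable_of_hasCompactSupport hcX.mul_left
  have i4 : Integrable fun η => b η * Yd g η :=
    (hb.continuous.mul (continuous_Yd hg)).integrable_of_hasCompactSupport hcY.mul_left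
  simp_rw [Xd_mul hg ha] at hX
  simp_rw [Yd_mul hg hb] at hY
  rw [integral_add i1 i3] at hX
  rw [integral_add i2 i4] at hY
  simp_rw [mul_add]
  rw [integral_add i1 i2, integral_add i3 i4]
  linarith

/-- The set of fluxes defining the horizontal perimeter of a `C¹` domain is bounded. -/
lemma bddAbove_horizPerim {Ω : Set H1} (hΩb : Bornology.IsBounded Ω) (hC1 : c1Bdry Ω) :
    BddAbove { p : ℝ | ∃ a b : H1 → ℝ, ContDiff ℝ 1 a ∧ ContDiff ℝ 1 b ∧
      (∀ η, a η ^ 2 + b η ^ 2 ≤ 1) ∧ p = ∫ η in Ω, (Xd a η + Yd b η) } := by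
  obtain ⟨f, hf, hΩ, -, hreg⟩ := hC1
  obtain ⟨C, hC, ε₀, hε₀, hlayer⟩ := exists_volume_layer_le hΩb hf hΩ hreg
  obtain ⟨L, hL0, hL⟩ := exists_abs_deriv_smoothTransition_le
  have hcl : IsCompact (closure Ω) := hΩb.isCompact_closure
  obtain ⟨B, hBnn, hB⟩ : ∃ B : ℝ, 0 ≤ B ∧ ∀ η ∈ closure Ω, ‖|Xd f η| + |Yd f η|‖ ≤ B := by
    obtain ⟨B, hB⟩ := hcl.exists_bound_of_continuousOn
      (((continuous_Xd hf).abs.add (continuous_Yd hf).abs).continuousOn)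
    exact ⟨max B 0, le_max_right _ _, fun η hη => (hB η hη).trans (le_max_left _ _)⟩
  have hΩm : MeasurableSet Ω := by
    rw [hΩ]; exact (isOpen_lt hf.continuous continuous_const).measurableSet
  refine ⟨L * B * C.toReal, ?_⟩
  rintro _ ⟨a, b, ha, hb, hab, rfl⟩
  set D : H1 → ℝ := fun η => Xd a η + Yd b η with hD
  have hDc : Continuous D := (continuous_Xd ha).add (continuous_Yd hb)
  have hDi : IntegrableOn D Ω := (hDc.continuousOn.integrableOn_compact hcl).mono_set subset_closure
  let σ : ℕ → H1 → ℝ := fun n η => Real.smoothTransition (-((n : ℝ) + 1) * f η)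
  have hσ : ∀ n, ContDiff ℝ 1 (σ n) := fun n =>
    Real.smoothTransition.contDiff.comp (contDiff_const.mul hf)
  have hσ0 : ∀ n η, η ∉ Ω → σ n η = 0 := by
    intro n η hη
    have : 0 ≤ f η := by rw [hΩ] at hη; simpa using hη
    refine Real.smoothTransition.zero_of_nonpos ?_
    have : (0 : ℝ) ≤ ((n : ℝ) + 1) * f η := by positivity
    linarith
  have hσc : ∀ n, HasCompactSupport (σ n) := fun n =>
    HasCompactSupport.of_support_subset_isCompact hcl fun η hη => by
      by_contra h
      exact hη (hσ0 n η fun h' => h (subset_closure h'))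
  have hlim : Filter.Tendsto (fun n => ∫ η in Ω, σ n η * D η) Filter.atTop
      (nhds (∫ η in Ω, D η)) := by
    refine tendsto_integral_of_dominated_convergence (fun η => |D η|)
      (fun n => ((hσ n).continuous.mul hDc).aestronglyMeasurable) hDi.abs ?_ ?_
    · refine fun n => Filter.Eventually.of_forall fun η => ?_
      rw [norm_mul, Real.norm_eq_abs, Real.norm_eq_abs,
        abs_of_nonneg (Real.smoothTransition.nonneg _)]
      exact mul_le_of_le_one_left (abs_nonneg _) (Real.smoothTransition.le_one _)
    · refine (ae_restrict_iff' hΩm).2 (Filter.Eventually.of_forall fun η hη => ?_)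
      have hfη : f η < 0 := by rw [hΩ] at hη; exact hη
      refine tendsto_const_nhds.congr' ?_
      obtain ⟨N, hN⟩ := exists_nat_gt (1 / (-f η))
      filter_upwards [Filter.eventually_ge_atTop N] with n hn
      have hn' : (N : ℝ) ≤ n := by exact_mod_cast hn
      have : 1 ≤ -((n : ℝ) + 1) * f η := by
        have := (div_lt_iff₀ (by linarith : 0 < -f η)).1 hN
        nlinarith
      show D η = Real.smoothTransition _ * D η
      rw [Real.smoothTransition.one_of_one_le this, one_mul]
  have hXσ : ∀ n η, Xd (σ n) η
      = deriv Real.smoothTransition (-((n : ℝ) + 1) * f η) * (-((n : ℝ) + 1) * Xd f η) := by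
    intro n η
    have h1 : HasDerivAt Real.smoothTransition _ (-((n : ℝ) + 1) * f η) :=
      ((Real.smoothTransition.contDiff (n := 1)).differentiable one_ne_zero _).hasDerivAt
    have h2 := h1.comp_hasFDerivAt η (((hf.differentiable one_ne_zero) η).hasFDerivAt.const_mul
      (-((n : ℝ) + 1)))
    unfold Xd
    rw [show σ n = Real.smoothTransition ∘ fun η => -((n : ℝ) + 1) * f η from rfl, h2.fderiv]
    simp
  have hYσ : ∀ n η, Yd (σ n) η
      = deriv Real.smoothTransition (-((n : ℝ) + 1) * f η) * (-((n : ℝ) + 1) * Yd f η) := by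
    intro n η
    have h1 : HasDerivAt Real.smoothTransition _ (-((n : ℝ) + 1) * f η) :=
      ((Real.smoothTransition.contDiff (n := 1)).differentiable one_ne_zero _).hasDerivAt
    have h2 := h1.comp_hasFDerivAt η (((hf.differentiable one_ne_zero) η).hasFDerivAt.const_mul
      (-((n : ℝ) + 1)))
    unfold Yd
    rw [show σ n = Real.smoothTransition ∘ fun η => -((n : ℝ) + 1) * f η from rfl, h2.fderiv]
    simp
  have hdσ : ∀ x ≤ (0 : ℝ), deriv Real.smoothTransition x = 0 := by
    intro x hx
    have : IsLocalMin Real.smoothTransition x := Filter.Eventually.of_forall fun y => by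
      rw [Real.smoothTransition.zero_of_nonpos hx]; exact Real.smoothTransition.nonneg y
    exact this.deriv_eq_zero
  have hdσ1 : ∀ x ≥ (1 : ℝ), deriv Real.smoothTransition x = 0 := by
    intro x hx
    have : IsLocalMax Real.smoothTransition x := Filter.Eventually.of_forall fun y => by
      rw [Real.smoothTransition.one_of_one_le hx]; exact Real.smoothTransition.le_one y
    exact this.deriv_eq_zero
  have hB0 : ∀ η ∈ Ω, |Xd f η| + |Yd f η| ≤ B := fun η hη => by
    have := hB η (subset_closure hη)
    rwa [Real.norm_of_nonneg (by positivity)] at this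
  refine le_of_tendsto hlim ?_
  obtain ⟨N, hN⟩ := exists_nat_gt (1 / ε₀)
  filter_upwards [Filter.eventually_ge_atTop N] with n hn
  have hn1 : (0 : ℝ) < (n : ℝ) + 1 := by positivity
  have hlt : 1 / ((n : ℝ) + 1) < ε₀ := by
    have hn' : (N : ℝ) ≤ n := by exact_mod_cast hn
    rw [div_lt_iff₀ hn1]
    have := (div_lt_iff₀ hε₀).1 hN
    nlinarith
  have hvol := hlayer _ (by positivity) hlt
  set S := {x | -(1 / ((n : ℝ) + 1)) < f x ∧ f x < 0} with hS
  have hSΩ : S ⊆ Ω := fun x hx => by rw [hΩ]; exact hx.2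
  have hSm : MeasurableSet S := by
    have := hf.continuous
    exact ((isOpen_lt continuous_const this).inter (isOpen_lt this continuous_const)).measurableSet
  have hfull : ∫ η in Ω, σ n η * D η = ∫ η, σ n η * D η :=
    setIntegral_eq_integral_of_forall_compl_eq_zero fun η hη => by rw [hσ0 n η hη, zero_mul]
  rw [hfull, integral_mul_horizontal_div (hσ n) (hσc n) ha hb, ← integral_neg]
  have hptw : ∀ η ∉ S, -(a η * Xd (σ n) η + b η * Yd (σ n) η) = 0 := by
    intro η hη
    have : deriv Real.smoothTransition (-((n : ℝ) + 1) * f η) = 0 := by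
      rcases le_or_gt 0 (f η) with h | h
      · apply hdσ; nlinarith
      · apply hdσ1
        have : f η ≤ -(1 / ((n : ℝ) + 1)) := by
          by_contra h'; exact hη ⟨not_le.1 h', h⟩
        have h3 : ((n : ℝ) + 1) * (1 / ((n : ℝ) + 1)) = 1 := by field_simp
        nlinarith
    rw [hXσ, hYσ, this]; ring
  rw [← setIntegral_eq_integral_of_forall_compl_eq_zero hptw]
  have hle : ∀ η ∈ S, ‖-(a η * Xd (σ n) η + b η * Yd (σ n) η)‖ ≤ L * ((n : ℝ) + 1) * B := by
    intro η hη
    have ha1 : |a η| ≤ 1 := (sq_le_one_iff_abs_le_one _).1 (by linarith [hab η, sq_nonneg (b η)])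
    have hb1 : |b η| ≤ 1 := (sq_le_one_iff_abs_le_one _).1 (by linarith [hab η, sq_nonneg (a η)])
    rw [norm_neg, hXσ, hYσ, Real.norm_eq_abs]
    set d := deriv Real.smoothTransition (-((n : ℝ) + 1) * f η) with hd
    have e : a η * (d * (-((n : ℝ) + 1) * Xd f η)) + b η * (d * (-((n : ℝ) + 1) * Yd f η))
        = d * (-((n : ℝ) + 1)) * (a η * Xd f η + b η * Yd f η) := by ring
    rw [e, abs_mul, abs_mul, abs_neg, abs_of_pos hn1]
    have h1 : |a η * Xd f η + b η * Yd f η| ≤ B := by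
      refine (abs_add_le _ _).trans (le_trans ?_ (hB0 η (hSΩ hη)))
      rw [abs_mul, abs_mul]
      exact add_le_add (mul_le_of_le_one_left (abs_nonneg _) ha1)
        (mul_le_of_le_one_left (abs_nonneg _) hb1)
    have := hL (-((n : ℝ) + 1) * f η)
    gcongr
  have hSfin : volume S < ⊤ := (measure_mono hSΩ).trans_lt hΩb.measure_lt_top
  have hbd := norm_setIntegral_le_of_norm_le_const hSfin hle
  refine (le_abs_self _).trans (hbd.trans ?_)
  have hvr : volume.real S ≤ C.toReal * (1 / ((n : ℝ) + 1)) := by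
    have := ENNReal.toReal_mono (ENNReal.mul_ne_top hC ENNReal.ofReal_ne_top) hvol
    rwa [ENNReal.toReal_mul, ENNReal.toReal_ofReal (by positivity)] at this
  calc L * ((n : ℝ) + 1) * B * volume.real S
      ≤ L * ((n : ℝ) + 1) * B * (C.toReal * (1 / ((n : ℝ) + 1))) := by gcongr
    _ = L * B * C.toReal := by field_simp

/-- The squared horizontal radius `x² + y²`. -/
def horizSq (ζ : H1) : ℝ := ζ.1 ^ 2 + ζ.2.1 ^ 2

/-- The fourth power `(x² + y²)² + t²` of the Koranyi norm. -/
def gaugePow (ζ : H1) : ℝ := horizSq ζ ^ 2 + ζ.2.2 ^ 2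

lemma horizSq_nonneg (ζ : H1) : 0 ≤ horizSq ζ := by unfold horizSq; positivity

lemma gaugePow_nonneg (ζ : H1) : 0 ≤ gaugePow ζ := by unfold gaugePow; positivity

@[fun_prop] lemma continuous_horizSq : Continuous horizSq := by unfold horizSq; fun_prop

@[fun_prop] lemma continuous_gaugePow : Continuous gaugePow := by unfold gaugePow; fun_prop

/-- Integration of a radial function on the plane, in terms of the squared radius. -/
lemma lintegral_radial {G : ℝ → ENNReal} (hG : Measurable G) :
    ∫⁻ p : ℝ × ℝ, G (p.1 ^ 2 + p.2 ^ 2) = ENNReal.ofReal π * ∫⁻ A in Ioi (0 : ℝ), G A := by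
  have himg : (fun r : ℝ => r ^ 2) '' Ioi 0 = Ioi 0 := by
    ext A
    constructor
    · rintro ⟨r, hr, rfl⟩; exact pow_pos (mem_Ioi.1 hr) 2
    · intro hA; exact ⟨√A, Real.sqrt_pos.2 hA, Real.sq_sqrt (le_of_lt hA)⟩
  have hcv : ∫⁻ A in Ioi (0 : ℝ), G A = ∫⁻ r in Ioi (0 : ℝ), ENNReal.ofReal |2 * r| * G (r ^ 2) := by
    conv_lhs => rw [← himg]
    refine lintegral_image_eq_lintegral_abs_deriv_mul measurableSet_Ioi (fun r _ => ?_) ?_ G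
    · simpa using (hasDerivAt_pow 2 r).hasDerivWithinAt
    · intro r hr s hs h
      exact (pow_left_inj₀ (le_of_lt hr) (le_of_lt hs) two_ne_zero).1 h
  rw [← lintegral_comp_polarCoord_symm]
  have hpt : ∀ p : ℝ × ℝ, ENNReal.ofReal p.1 • G ((polarCoord.symm p).1 ^ 2 +
      (polarCoord.symm p).2 ^ 2) = (ENNReal.ofReal p.1 * G (p.1 ^ 2)) * 1 := by
    intro p
    simp only [polarCoord_symm_apply, smul_eq_mul, mul_one]
    congr 2
    linear_combination p.1 ^ 2 * Real.sin_sq_add_cos_sq p.2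
  simp_rw [hpt]
  rw [polarCoord_target, Measure.volume_eq_prod, ← Measure.prod_restrict,
    lintegral_prod_mul (f := fun r => ENNReal.ofReal r * G (r ^ 2)) (g := fun _ => 1)
      (by fun_prop) (by fun_prop), hcv]
  have h2 : ∫⁻ r in Ioi (0 : ℝ), ENNReal.ofReal |2 * r| * G (r ^ 2)
      = 2 * ∫⁻ r in Ioi (0 : ℝ), ENNReal.ofReal r * G (r ^ 2) := by
    rw [← lintegral_const_mul _ (by fun_prop)]
    refine setLIntegral_congr_fun measurableSet_Ioi fun r hr => ?_
    have hr' : (0 : ℝ) < r := hr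
    show ENNReal.ofReal |2 * r| * G (r ^ 2) = 2 * (ENNReal.ofReal r * G (r ^ 2))
    rw [abs_of_pos (by positivity), ENNReal.ofReal_mul zero_le_two, ENNReal.ofReal_ofNat, mul_assoc]
  rw [h2]
  simp only [lintegral_const, MeasurableSet.univ, Measure.restrict_apply, univ_inter, one_mul,
    Real.volume_Ioo]
  rw [show π - -π = π * 2 by ring, ENNReal.ofReal_mul pi_pos.le, ENNReal.ofReal_ofNat]
  ring

/-- Integration over the Heisenberg group of a function of `x² + y²` and `t`. -/
lemma lintegral_cylindrical {F : ℝ × ℝ → ENNReal} (hF : Measurable F) :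
    ∫⁻ ζ : H1, F (horizSq ζ, ζ.2.2)
      = ENNReal.ofReal π * ∫⁻ p in Ioi (0 : ℝ) ×ˢ (univ : Set ℝ), F p := by
  have hm : Measurable fun ζ : H1 => F (horizSq ζ, ζ.2.2) := by unfold horizSq; fun_prop
  have hG : Measurable fun A : ℝ => ∫⁻ t, F (A, t) := hF.lintegral_prod_right'
  calc ∫⁻ ζ : H1, F (horizSq ζ, ζ.2.2)
      = ∫⁻ x : ℝ, ∫⁻ q : ℝ × ℝ, F (x ^ 2 + q.1 ^ 2, q.2) := by
        rw [Measure.volume_eq_prod, lintegral_prod _ hm.aemeasurable]; rfl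
    _ = ∫⁻ x : ℝ, ∫⁻ y : ℝ, ∫⁻ t : ℝ, F (x ^ 2 + y ^ 2, t) := by
        refine lintegral_congr fun x => ?_
        rw [Measure.volume_eq_prod, lintegral_prod _ (by fun_prop)]
    _ = ∫⁻ p : ℝ × ℝ, ∫⁻ t : ℝ, F (p.1 ^ 2 + p.2 ^ 2, t) := by
        rw [Measure.volume_eq_prod, lintegral_prod]
        exact (hG.comp (by fun_prop : Measurable fun p : ℝ × ℝ => p.1 ^ 2 + p.2 ^ 2)).aemeasurable
    _ = ENNReal.ofReal π * ∫⁻ A in Ioi (0 : ℝ), ∫⁻ t, F (A, t) := lintegral_radial hG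
    _ = _ := by
        rw [Measure.volume_eq_prod, ← Measure.prod_restrict, lintegral_prod _ hF.aemeasurable,
          Measure.restrict_univ]

/-- The area of the disc of diameter `1 / s` tangent to the vertical axis at the origin. -/
lemma volume_tangent_disc {s : ℝ} (hs : 0 < s) :
    volume {p : ℝ × ℝ | s * (p.1 ^ 2 + p.2 ^ 2) < p.1} = ENNReal.ofReal (π / (4 * s ^ 2)) := by
  rw [← Complex.volume_preserving_equiv_real_prod.measure_preimage]
  · have : Complex.measurableEquivRealProd ⁻¹' {p : ℝ × ℝ | s * (p.1 ^ 2 + p.2 ^ 2) < p.1}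
        = Metric.ball (((1 / (2 * s) : ℝ) : ℂ)) (1 / (2 * s)) := by
      ext z
      rw [Metric.mem_ball, ← sq_lt_sq₀ dist_nonneg (by positivity), dist_eq_norm,
        ← Complex.normSq_eq_norm_sq, Complex.normSq_apply]
      simp only [mem_preimage, Complex.measurableEquivRealProd_apply, mem_ofPred_eq, Complex.sub_re,
        Complex.ofReal_re, Complex.sub_im, Complex.ofReal_im, sub_zero]
      have e : (z.re - 1 / (2 * s)) * (z.re - 1 / (2 * s)) + z.im * z.im - (1 / (2 * s)) ^ 2
          = (s * (z.re ^ 2 + z.im ^ 2) - z.re) / s := by field_simp; ring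
      rw [← sub_neg, ← sub_neg (b := (1 / (2 * s)) ^ 2), e, div_neg_iff]
      constructor
      · intro h; exact Or.inr ⟨h, hs⟩
      · rintro (h | h)
        · exact absurd h.2 (not_lt.2 hs.le)
        · exact h.1
    rw [this, Complex.volume_ball, ← ENNReal.ofReal_pow (by positivity),
      show (NNReal.pi : ENNReal) = ENNReal.ofReal π by
        rw [ENNReal.ofReal, ← NNReal.coe_real_pi, Real.toNNReal_coe],
      ← ENNReal.ofReal_mul (by positivity)]
    congr 1
    field_simp; ring
  · exact (isOpen_lt (by fun_prop) (by fun_prop)).measurableSet.nullMeasurableSet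

/-- Volume of the superlevel sets of `(x² + y²) / ρ⁴`. -/
lemma volume_superlevel_le {s : ℝ} (hs : 0 < s) :
    volume {ζ : H1 | s * gaugePow ζ < horizSq ζ} ≤ ENNReal.ofReal (π ^ 2 / (4 * s ^ 2)) := by
  set D := {p : ℝ × ℝ | s * (p.1 ^ 2 + p.2 ^ 2) < p.1} with hD
  have hDm : MeasurableSet D := (isOpen_lt (by fun_prop) (by fun_prop)).measurableSet
  have hSm : MeasurableSet {ζ : H1 | s * gaugePow ζ < horizSq ζ} :=
    (isOpen_lt (by fun_prop) (by fun_prop)).measurableSet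
  rw [← lintegral_indicator_one hSm]
  have := lintegral_cylindrical (F := D.indicator 1) (measurable_one.indicator hDm)
  calc ∫⁻ ζ : H1, {ζ : H1 | s * gaugePow ζ < horizSq ζ}.indicator 1 ζ
      = ∫⁻ ζ : H1, D.indicator 1 (horizSq ζ, ζ.2.2) := rfl
    _ = ENNReal.ofReal π * ∫⁻ p in Ioi (0 : ℝ) ×ˢ (univ : Set ℝ), D.indicator 1 p := this
    _ ≤ ENNReal.ofReal π * ∫⁻ p, D.indicator 1 p := by
        gcongr; exact Measure.restrict_le_self
    _ = ENNReal.ofReal (π ^ 2 / (4 * s ^ 2)) := by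
        rw [lintegral_indicator_one hDm, volume_tangent_disc hs, ← ENNReal.ofReal_mul pi_pos.le]
        congr 1; ring

lemma lintegral_comp_const_add_mul {g : ℝ → ENNReal} (hg : Measurable g) (c : ℝ) {r : ℝ}
    (hr : 0 < r) : ENNReal.ofReal r * ∫⁻ x, g (c + r * x) = ∫⁻ x, g x := by
  rw [← lintegral_add_left_eq_self g c]
  have h := Real.smul_map_volume_mul_left hr.ne'
  conv_rhs => rw [← h]
  rw [lintegral_smul_measure, lintegral_map (by fun_prop) (by fun_prop), abs_of_pos hr, smul_eq_mul]

/-- Behaviour of the Lebesgue measure under Heisenberg translations and dilations. -/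
lemma lintegral_comp_hmul_dilation {F : H1 → ENNReal} (hF : Measurable F) (η : H1) {r : ℝ}
    (hr : 0 < r) :
    ENNReal.ofReal (r ^ 4) * ∫⁻ ζ : H1, F (hmul η (r * ζ.1, r * ζ.2.1, r ^ 2 * ζ.2.2))
      = ∫⁻ ζ, F ζ := by
  have hx : Measurable fun x => ∫⁻ y, ∫⁻ t, F (x, y, t) := by
    refine Measurable.lintegral_prod_right' (f := fun p : ℝ × ℝ => ∫⁻ t, F (p.1, p.2, t)) ?_
    exact Measurable.lintegral_prod_right'
      (f := fun p : (ℝ × ℝ) × ℝ => F (p.1.1, p.1.2, p.2)) (by fun_prop)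
  have hy : ∀ x, Measurable fun y => ∫⁻ t, F (x, y, t) := fun x =>
    Measurable.lintegral_prod_right' (f := fun p : ℝ × ℝ => F (x, p.1, p.2)) (by fun_prop)
  have hiter : ∀ G : H1 → ENNReal, Measurable G →
      ∫⁻ ζ, G ζ = ∫⁻ x, ∫⁻ y, ∫⁻ t, G (x, y, t) := by
    intro G hG
    rw [Measure.volume_eq_prod, lintegral_prod _ hG.aemeasurable]
    refine lintegral_congr fun x => ?_
    rw [Measure.volume_eq_prod, lintegral_prod _ (by fun_prop)]
  have hr2 : 0 < r ^ 2 := by positivity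
  have hr4 : ENNReal.ofReal (r ^ 4)
      = ENNReal.ofReal r * (ENNReal.ofReal r * ENNReal.ofReal (r ^ 2)) := by
    rw [← ENNReal.ofReal_mul hr.le, ← ENNReal.ofReal_mul hr.le]; congr 1; ring
  have hmm : Measurable fun ζ : H1 => hmul η (r * ζ.1, r * ζ.2.1, r ^ 2 * ζ.2.2) := by
    unfold hmul; fun_prop
  rw [hiter F hF, hiter (fun ζ => F (hmul η (r * ζ.1, r * ζ.2.1, r ^ 2 * ζ.2.2)))
    (hF.comp hmm), hr4]
  have ht : ∀ x y, ENNReal.ofReal (r ^ 2) *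
      ∫⁻ t, F (hmul η (r * x, r * y, r ^ 2 * t)) = ∫⁻ t, F (η.1 + r * x, η.2.1 + r * y, t) := by
    intro x y
    rw [← lintegral_comp_const_add_mul
      (by fun_prop : Measurable fun t => F (η.1 + r * x, η.2.1 + r * y, t))
      (η.2.2 + 2 * (r * x * η.2.1 - η.1 * (r * y))) hr2]
    congr 1
    refine lintegral_congr fun t => ?_
    unfold hmul
    congr 3
    ring
  have hin : Measurable fun p : ℝ × ℝ => ∫⁻ t, F (hmul η (r * p.1, r * p.2, r ^ 2 * t)) := by
    refine Measurable.lintegral_prod_right' (f := fun p : (ℝ × ℝ) × ℝ =>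
      F (hmul η (r * p.1.1, r * p.1.2, r ^ 2 * p.2))) (hF.comp ?_)
    unfold hmul; fun_prop
  have h2 : ∀ x, ENNReal.ofReal r * (ENNReal.ofReal (r ^ 2) *
      ∫⁻ y, ∫⁻ t, F (hmul η (r * x, r * y, r ^ 2 * t))) = ∫⁻ y, ∫⁻ t, F (η.1 + r * x, y, t) := by
    intro x
    have hix : Measurable fun y => ∫⁻ t, F (hmul η (r * x, r * y, r ^ 2 * t)) :=
      hin.comp (by fun_prop : Measurable fun y : ℝ => (x, y))
    rw [← lintegral_const_mul _ hix]
    simp only [ht]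
    exact lintegral_comp_const_add_mul (hy _) _ hr
  have hin2 : Measurable fun x => ∫⁻ y, ∫⁻ t, F (hmul η (r * x, r * y, r ^ 2 * t)) :=
    Measurable.lintegral_prod_right' hin
  rw [mul_assoc, mul_assoc, ← lintegral_const_mul _ hin2, ← lintegral_const_mul _ (by fun_prop)]
  simp only [h2]
  exact lintegral_comp_const_add_mul hx _ hr

lemma lintegral_Ioi_cube_div :
    ∫⁻ r in Ioi (0 : ℝ), ENNReal.ofReal (r ^ 3 / (r ^ 2 + 1) ^ 3) = ENNReal.ofReal (1 / 4) := by
  have hder : ∀ r ∈ Ici (0 : ℝ), HasDerivAt (fun r : ℝ => -(2 * r ^ 2 + 1) / (4 * (r ^ 2 + 1) ^ 2))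
      (r ^ 3 / (r ^ 2 + 1) ^ 3) r := by
    intro r _
    have h1 : HasDerivAt (fun r : ℝ => -(2 * r ^ 2 + 1)) (-(2 * (2 * r))) r := by
      refine (((hasDerivAt_pow 2 r).const_mul 2).add_const 1).neg.congr_deriv ?_
      norm_num
    have h2 : HasDerivAt (fun r : ℝ => 4 * (r ^ 2 + 1) ^ 2) (4 * (2 * (r ^ 2 + 1) * (2 * r))) r := by
      simpa using (((hasDerivAt_pow 2 r).add_const 1).pow 2).const_mul 4
    refine (h1.div h2 (by positivity)).congr_deriv ?_
    field_simp; ring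
  have hnn : ∀ r ∈ Ioi (0 : ℝ), 0 ≤ r ^ 3 / (r ^ 2 + 1) ^ 3 := fun r hr => by
    have : (0 : ℝ) < r := hr
    positivity
  have hlim : Filter.Tendsto (fun r : ℝ => -(2 * r ^ 2 + 1) / (4 * (r ^ 2 + 1) ^ 2))
      Filter.atTop (nhds 0) := by
    have hsq : Filter.Tendsto (fun r : ℝ => (r ^ 2 + 1)⁻¹) Filter.atTop (nhds 0) :=
      Filter.Tendsto.inv_tendsto_atTop
        (Filter.tendsto_atTop_add_const_right _ _ (Filter.tendsto_pow_atTop two_ne_zero))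
    have : Filter.Tendsto (fun r : ℝ => -(1 / 2) * (r ^ 2 + 1)⁻¹ + 1 / 4 * ((r ^ 2 + 1)⁻¹) ^ 2)
        Filter.atTop (nhds (-(1 / 2) * 0 + 1 / 4 * 0 ^ 2)) :=
      (hsq.const_mul _).add ((hsq.pow 2).const_mul _)
    convert this using 2 with r
    · field_simp; ring
    · norm_num
  have hint := integrableOn_Ioi_deriv_of_nonneg' hder hnn hlim
  rw [← ofReal_integral_eq_lintegral_ofReal hint
    ((ae_restrict_iff' measurableSet_Ioi).2 (Filter.Eventually.of_forall hnn)),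
    integral_Ioi_of_hasDerivAt_of_nonneg' hder hnn hlim]
  norm_num

lemma lintegral_Ioo_cos_sq :
    ∫⁻ θ in Ioo (-(π / 2)) (π / 2), ENNReal.ofReal (cos θ ^ 2) = ENNReal.ofReal (π / 2) := by
  have hle : -(π / 2) ≤ π / 2 := by linarith [pi_pos]
  have hi : IntervalIntegrable (fun θ => cos θ ^ 2) volume (-(π / 2)) (π / 2) :=
    (by fun_prop : Continuous fun θ : ℝ => cos θ ^ 2).intervalIntegrable _ _
  rw [← ofReal_integral_eq_lintegral_ofReal, ← integral_Ioc_eq_integral_Ioo,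
    ← intervalIntegral.integral_of_le hle, integral_cos_sq]
  · simp only [cos_pi_div_two, cos_neg, zero_mul, sub_zero]; congr 1; ring
  · exact ((intervalIntegrable_iff_integrableOn_Ioc_of_le hle).1 hi).mono_set Ioo_subset_Ioc_self
  · exact Filter.Eventually.of_forall fun θ => sq_nonneg _

/-- A normalised bump function whose dilates form an approximate identity. -/
def bump (ζ : H1) : ℝ := 8 / π ^ 2 * (horizSq ζ ^ 2 / (gaugePow ζ + 1) ^ 3)

lemma continuous_bump : Continuous bump := by
  refine continuous_const.mul ((continuous_horizSq.pow 2).div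
    ((continuous_gaugePow.add continuous_const).pow 3) fun ζ => ?_)
  have := gaugePow_nonneg ζ
  positivity

lemma one_le_lintegral_bump : 1 ≤ ∫⁻ ζ, ENNReal.ofReal (bump ζ) := by
  let F : ℝ × ℝ → ENNReal := fun p =>
    ENNReal.ofReal (8 / π ^ 2 * (p.1 ^ 2 / (p.1 ^ 2 + p.2 ^ 2 + 1) ^ 3))
  have hF : Measurable F := by fun_prop
  have hcyl : ∫⁻ ζ, ENNReal.ofReal (bump ζ) = _ := lintegral_cylindrical hF
  have hHm : MeasurableSet (Ioi (0 : ℝ) ×ˢ (univ : Set ℝ)) := measurableSet_Ioi.prod .univ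
  rw [hcyl, ← lintegral_indicator hHm, ← lintegral_comp_polarCoord_symm]
  have hsub : Ioi (0 : ℝ) ×ˢ Ioo (-(π / 2)) (π / 2) ⊆ polarCoord.target := by
    rw [polarCoord_target]
    exact prod_mono subset_rfl (Ioo_subset_Ioo (by linarith [pi_pos]) (by linarith [pi_pos]))
  calc (1 : ENNReal) = ENNReal.ofReal π * (ENNReal.ofReal (1 / 4) *
        (ENNReal.ofReal (8 / π ^ 2) * ENNReal.ofReal (π / 2))) := by
        rw [← ENNReal.ofReal_mul (by positivity), ← ENNReal.ofReal_mul (by positivity),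
          ← ENNReal.ofReal_mul (by positivity), ← ENNReal.ofReal_one]
        congr 1; field_simp; norm_num
    _ = ENNReal.ofReal π * ∫⁻ p in Ioi (0 : ℝ) ×ˢ Ioo (-(π / 2)) (π / 2),
          ENNReal.ofReal (p.1 ^ 3 / (p.1 ^ 2 + 1) ^ 3) *
            (ENNReal.ofReal (8 / π ^ 2) * ENNReal.ofReal (cos p.2 ^ 2)) := by
        rw [Measure.volume_eq_prod, ← Measure.prod_restrict,
          lintegral_prod_mul (f := fun r : ℝ => ENNReal.ofReal (r ^ 3 / (r ^ 2 + 1) ^ 3))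
            (g := fun θ : ℝ => ENNReal.ofReal (8 / π ^ 2) * ENNReal.ofReal (cos θ ^ 2))
            (by fun_prop) (by fun_prop), lintegral_Ioi_cube_div,
          lintegral_const_mul _ (by fun_prop), lintegral_Ioo_cos_sq]
    _ ≤ ENNReal.ofReal π * ∫⁻ p in Ioi (0 : ℝ) ×ˢ Ioo (-(π / 2)) (π / 2), ENNReal.ofReal p.1 •
          (Ioi (0 : ℝ) ×ˢ univ).indicator F (polarCoord.symm p) := by
        gcongr 1
        refine setLIntegral_mono' (measurableSet_Ioi.prod measurableSet_Ioo) fun p hp => ?_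
        have hp1 : 0 < p.1 := hp.1
        have hcos : 0 < cos p.2 := cos_pos_of_mem_Ioo hp.2
        have hmem : polarCoord.symm p ∈ Ioi (0 : ℝ) ×ˢ (univ : Set ℝ) :=
          ⟨by simpa using mul_pos hp1 hcos, mem_univ _⟩
        rw [indicator_of_mem hmem, smul_eq_mul]
        dsimp only [F]
        rw [← ENNReal.ofReal_mul (by positivity), ← ENNReal.ofReal_mul (by positivity),
          ← ENNReal.ofReal_mul (by positivity)]
        refine ENNReal.ofReal_le_ofReal (le_of_eq ?_)
        simp only [polarCoord_symm_apply]
        have e : (p.1 * cos p.2) ^ 2 + (p.1 * sin p.2) ^ 2 = p.1 ^ 2 := by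
          linear_combination p.1 ^ 2 * Real.sin_sq_add_cos_sq p.2
        rw [e]; ring
    _ ≤ _ := by
        gcongr 1
        exact lintegral_mono_set hsub

/-- Heisenberg translations preserve volume. -/
lemma volume_preimage_hmul_hinv (η : H1) {E : Set H1} (hE : MeasurableSet E) :
    volume {ξ | hmul (hinv η) ξ ∈ E} = volume E := by
  have hm : Measurable fun ξ => hmul (hinv η) ξ := by unfold hmul; fun_prop
  have hE' : MeasurableSet {ξ | hmul (hinv η) ξ ∈ E} := hm hE
  rw [← lintegral_indicator_one hE, ← lintegral_indicator_one hE']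
  have := lintegral_comp_hmul_dilation
    (F := {ξ | hmul (hinv η) ξ ∈ E}.indicator 1) (measurable_one.indicator hE') η one_pos
  simp only [one_pow, ENNReal.ofReal_one, one_mul] at this
  refine this.symm.trans (lintegral_congr fun ζ => ?_)
  have e : hmul (hinv η) (hmul η (ζ.1, ζ.2.1, ζ.2.2)) = ζ := by
    ext <;> simp [hmul, hinv]; ring
  exact congrArg (E.indicator (1 : H1 → ENNReal)) e

lemma horizSq_hmul_hinv_comm (ξ η : H1) :
    horizSq (hmul (hinv ξ) η) = horizSq (hmul (hinv η) ξ) := by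
  simp only [horizSq, hmul, hinv]; ring

lemma gaugePow_hmul_hinv_comm (ξ η : H1) :
    gaugePow (hmul (hinv ξ) η) = gaugePow (hmul (hinv η) ξ) := by
  simp only [gaugePow, horizSq, hmul, hinv]; ring

/-- Rearrangement bound for the potential of a set of given volume. -/
lemma lintegral_rpow_kernel_le {Ω : Set H1} {s : ℝ} (hs : 0 < s)
    (hvol : volume Ω ≤ ENNReal.ofReal (π ^ 2 / (4 * s ^ 2))) (η : H1) :
    ∫⁻ ξ in Ω, ENNReal.ofReal
        ((horizSq (hmul (hinv ξ) η) / gaugePow (hmul (hinv ξ) η)) ^ (3 / 2 : ℝ))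
      ≤ ENNReal.ofReal (π ^ 2 * s ^ (-(1 / 2) : ℝ)) := by
  have hcξ : Continuous fun ξ : H1 => hmul (hinv ξ) η := by unfold hmul hinv; fun_prop
  have hc : Measurable fun ξ : H1 => horizSq (hmul (hinv ξ) η) / gaugePow (hmul (hinv ξ) η) :=
    (continuous_horizSq.comp hcξ).measurable.div (continuous_gaugePow.comp hcξ).measurable
  rw [lintegral_rpow_eq_lintegral_meas_lt_mul _
    (Filter.Eventually.of_forall fun ξ => div_nonneg (horizSq_nonneg _) (gaugePow_nonneg _))
    hc.aemeasurable (by norm_num)]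
  have hlevel : ∀ t : ℝ, 0 < t → volume.restrict Ω
      {ξ : H1 | t < horizSq (hmul (hinv ξ) η) / gaugePow (hmul (hinv ξ) η)}
        ≤ ENNReal.ofReal (π ^ 2 / (4 * t ^ 2)) := by
    intro t ht
    refine (Measure.restrict_apply_le _ _).trans (le_trans ?_ (volume_superlevel_le ht))
    have hE : MeasurableSet {ζ : H1 | t * gaugePow ζ < horizSq ζ} :=
      (isOpen_lt (by fun_prop) (by fun_prop)).measurableSet
    rw [← volume_preimage_hmul_hinv η hE]
    refine measure_mono fun ξ hξ => ?_
    have hξ' : t < horizSq (hmul (hinv ξ) η) / gaugePow (hmul (hinv ξ) η) := hξ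
    show t * gaugePow (hmul (hinv η) ξ) < horizSq (hmul (hinv η) ξ)
    rw [← horizSq_hmul_hinv_comm, ← gaugePow_hmul_hinv_comm]
    have hpos : 0 < gaugePow (hmul (hinv ξ) η) := by
      refine (gaugePow_nonneg _).lt_of_ne fun h => ?_
      rw [← h, div_zero] at hξ'
      exact absurd ht (not_lt.2 hξ'.le)
    exact (lt_div_iff₀ hpos).1 hξ'
  have hsmall : ∀ A : Set H1, volume.restrict Ω A ≤ ENNReal.ofReal (π ^ 2 / (4 * s ^ 2)) :=
    fun A => ((measure_mono (subset_univ A)).trans_eq (Measure.restrict_apply_univ _)).trans hvol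
  have h1 : ∫⁻ t in Ioc 0 s, volume.restrict Ω
      {ξ : H1 | t < horizSq (hmul (hinv ξ) η) / gaugePow (hmul (hinv ξ) η)} *
        ENNReal.ofReal (t ^ ((3 / 2 : ℝ) - 1))
      ≤ ENNReal.ofReal (π ^ 2 / (4 * s ^ 2) * (s ^ (3 / 2 : ℝ) / (3 / 2))) := by
    have hi : IntervalIntegrable (fun t : ℝ => t ^ ((3 / 2 : ℝ) - 1)) volume 0 s :=
      intervalIntegral.intervalIntegrable_rpow' (by norm_num)
    have hval : ∫⁻ t in Ioc 0 s, ENNReal.ofReal (t ^ ((3 / 2 : ℝ) - 1))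
        = ENNReal.ofReal (s ^ (3 / 2 : ℝ) / (3 / 2)) := by
      rw [← ofReal_integral_eq_lintegral_ofReal
        ((intervalIntegrable_iff_integrableOn_Ioc_of_le hs.le).1 hi),
        ← intervalIntegral.integral_of_le hs.le, integral_rpow (Or.inl (by norm_num))]
      · norm_num
      · exact (ae_restrict_iff' measurableSet_Ioc).2
          (Filter.Eventually.of_forall fun t ht => Real.rpow_nonneg ht.1.le _)
    rw [ENNReal.ofReal_mul (by positivity), ← hval, ← lintegral_const_mul _ (by fun_prop)]
    exact lintegral_mono fun t => mul_le_mul_left (hsmall _) _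
  have h2 : ∫⁻ t in Ioi s, volume.restrict Ω
      {ξ : H1 | t < horizSq (hmul (hinv ξ) η) / gaugePow (hmul (hinv ξ) η)} *
        ENNReal.ofReal (t ^ ((3 / 2 : ℝ) - 1))
      ≤ ENNReal.ofReal (π ^ 2 / 4 * (2 * s ^ (-(1 / 2) : ℝ))) := by
    have hval : ∫⁻ t in Ioi s, ENNReal.ofReal (t ^ (-(3 / 2) : ℝ))
        = ENNReal.ofReal (2 * s ^ (-(1 / 2) : ℝ)) := by
      rw [← ofReal_integral_eq_lintegral_ofReal (integrableOn_Ioi_rpow_of_lt (by norm_num) hs),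
        integral_Ioi_rpow_of_lt (by norm_num) hs]
      · congr 1
        rw [show (-(3 / 2) : ℝ) + 1 = -(1 / 2) by norm_num]
        field_simp
      · exact (ae_restrict_iff' measurableSet_Ioi).2
          (Filter.Eventually.of_forall fun t ht => Real.rpow_nonneg (hs.le.trans (le_of_lt ht)) _)
    rw [ENNReal.ofReal_mul (by positivity), ← hval, ← lintegral_const_mul _ (by fun_prop)]
    refine setLIntegral_mono' measurableSet_Ioi fun t ht => ?_
    have ht0 : 0 < t := hs.trans ht
    refine (mul_le_mul_left (hlevel t ht0) _).trans_eq ?_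
    rw [← ENNReal.ofReal_mul (by positivity), ← ENNReal.ofReal_mul (by positivity)]
    congr 1
    have e : t ^ ((3 / 2 : ℝ) - 1) = t ^ (-(3 / 2) : ℝ) * t ^ 2 := by
      rw [← Real.rpow_natCast, ← Real.rpow_add ht0]; norm_num
    rw [e]; field_simp
  rw [← Ioc_union_Ioi_eq_Ioi hs.le, lintegral_union measurableSet_Ioi (Ioc_disjoint_Ioi le_rfl)]
  refine (mul_le_mul_right (add_le_add h1 h2) _).trans_eq ?_
  rw [← ENNReal.ofReal_add (by positivity) (by positivity), ← ENNReal.ofReal_mul (by norm_num)]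
  congr 1
  have e : s ^ (3 / 2 : ℝ) = s ^ (-(1 / 2) : ℝ) * s ^ 2 := by
    rw [← Real.rpow_natCast, ← Real.rpow_add hs]; norm_num
  rw [e]; field_simp; ring

/-- The linear part of the left translation by `ζ`. -/
def hmulLin (ζ : H1) : H1 →L[ℝ] H1 :=
  ContinuousLinearMap.id ℝ H1 +
    ((2 * ζ.2.1) • (ContinuousLinearMap.inr ℝ ℝ (ℝ × ℝ)).comp
        ((ContinuousLinearMap.inr ℝ ℝ ℝ).comp (ContinuousLinearMap.fst ℝ ℝ (ℝ × ℝ))) -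
      (2 * ζ.1) • (ContinuousLinearMap.inr ℝ ℝ (ℝ × ℝ)).comp
        ((ContinuousLinearMap.inr ℝ ℝ ℝ).comp
          ((ContinuousLinearMap.fst ℝ ℝ ℝ).comp (ContinuousLinearMap.snd ℝ ℝ (ℝ × ℝ)))))

lemma hmulLin_apply (ζ v : H1) :
    hmulLin ζ v = (v.1, v.2.1, v.2.2 + (2 * ζ.2.1 * v.1 - 2 * ζ.1 * v.2.1)) := by
  ext <;> simp [hmulLin]

lemma hasFDerivAt_hmul (ζ η : H1) : HasFDerivAt (hmul ζ) (hmulLin ζ) η := by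
  have e : hmul ζ = fun η => ζ + hmulLin ζ η := by
    funext η
    rw [hmulLin_apply]
    ext <;> simp [hmul]; ring
  rw [e]
  exact (hmulLin ζ).hasFDerivAt.const_add ζ

lemma continuous_hmulLin : Continuous hmulLin := by
  unfold hmulLin
  fun_prop

/-- The derivative of a left translate. -/
lemma hasFDerivAt_comp_hmul {k : H1 → ℝ} (hk : ContDiff ℝ 1 k) (ζ η : H1) :
    HasFDerivAt (fun η => k (hmul ζ η)) ((fderiv ℝ k (hmul ζ η)).comp (hmulLin ζ)) η :=
  ((hk.differentiable one_ne_zero).differentiableAt.hasFDerivAt).comp η (hasFDerivAt_hmul ζ η)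

lemma fderiv_comp_hmulLin_X (k : H1 → ℝ) (ζ η : H1) :
    (fderiv ℝ k (hmul ζ η)).comp (hmulLin ζ) (1, 0, 2 * η.2.1) = Xd k (hmul ζ η) := by
  rw [ContinuousLinearMap.comp_apply, hmulLin_apply, Xd]
  congr 1
  ext <;> simp [hmul]; ring

lemma fderiv_comp_hmulLin_Y (k : H1 → ℝ) (ζ η : H1) :
    (fderiv ℝ k (hmul ζ η)).comp (hmulLin ζ) (0, 1, -2 * η.1) = Yd k (hmul ζ η) := by
  rw [ContinuousLinearMap.comp_apply, hmulLin_apply, Yd]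
  congr 1
  ext <;> simp [hmul]; ring

lemma exists_bound_ball_of_continuous {E : Type*} [NormedAddCommGroup E] {G : H1 × H1 → E}
    (hG : Continuous G) {Ω : Set H1} (hΩb : Bornology.IsBounded Ω) (η₀ : H1) :
    ∃ C, ∀ η ∈ Metric.ball η₀ 1, ∀ ξ ∈ Ω, ‖G (η, ξ)‖ ≤ C := by
  obtain ⟨C, hC⟩ := ((isCompact_closedBall η₀ 1).prod hΩb.isCompact_closure).exists_bound_of_continuousOn
    hG.continuousOn
  exact ⟨C, fun η hη ξ hξ => hC _ ⟨Metric.ball_subset_closedBall hη, subset_closure hξ⟩⟩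

lemma integrableOn_of_continuous_of_isBounded {E : Type*} [NormedAddCommGroup E] {g : H1 → E}
    (hg : Continuous g) {Ω : Set H1} (hΩb : Bornology.IsBounded Ω) : IntegrableOn g Ω :=
  (hg.continuousOn.integrableOn_compact hΩb.isCompact_closure).mono_set subset_closure

/-- The convolution of the indicator of `Ω` with the kernel `k`. -/
def potential (Ω : Set H1) (k : H1 → ℝ) (η : H1) : ℝ := ∫ ξ in Ω, k (hmul (hinv ξ) η)

section Potential

variable {Ω : Set H1} {k : H1 → ℝ}

lemma continuous_fderiv_translate (hk : ContDiff ℝ 1 k) : Continuous fun p : H1 × H1 =>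
    (fderiv ℝ k (hmul (hinv p.2) p.1)).comp (hmulLin (hinv p.2)) := by
  have h1 : Continuous fun p : H1 × H1 => hmul (hinv p.2) p.1 := by unfold hmul hinv; fun_prop
  have h2 : Continuous fun p : H1 × H1 => hmulLin (hinv p.2) :=
    continuous_hmulLin.comp (by unfold hinv; fun_prop)
  exact ((hk.continuous_fderiv one_ne_zero).comp h1).clm_comp h2

lemma hasFDerivAt_potential (hΩ : MeasurableSet Ω) (hΩb : Bornology.IsBounded Ω)
    (hk : ContDiff ℝ 1 k) (η : H1) :
    HasFDerivAt (potential Ω k)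
      (∫ ξ in Ω, (fderiv ℝ k (hmul (hinv ξ) η)).comp (hmulLin (hinv ξ))) η := by
  have hG := continuous_fderiv_translate hk
  obtain ⟨C, hC⟩ := exists_bound_ball_of_continuous hG hΩb η
  have hF : ∀ η, Continuous fun ξ => k (hmul (hinv ξ) η) := fun η =>
    hk.continuous.comp (by unfold hmul hinv; fun_prop)
  refine hasFDerivAt_integral_of_dominated_of_fderiv_le (bound := fun _ => C)
    (Metric.ball_mem_nhds η one_pos)
    (Filter.Eventually.of_forall fun η => (hF η).aestronglyMeasurable)
    (integrableOn_of_continuous_of_isBounded (hF η) hΩb)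
    (hG.comp (by fun_prop : Continuous fun ξ : H1 => (η, ξ))).aestronglyMeasurable
    ((ae_restrict_iff' hΩ).2 (Filter.Eventually.of_forall fun ξ hξ x hx => hC x hx ξ hξ))
    (integrableOn_of_continuous_of_isBounded continuous_const hΩb)
    (Filter.Eventually.of_forall fun ξ x _ => hasFDerivAt_comp_hmul hk (hinv ξ) x)

lemma contDiff_potential (hΩ : MeasurableSet Ω) (hΩb : Bornology.IsBounded Ω)
    (hk : ContDiff ℝ 1 k) : ContDiff ℝ 1 (potential Ω k) := by
  have hd := hasFDerivAt_potential hΩ hΩb hk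
  refine contDiff_one_iff_fderiv.2 ⟨fun η => (hd η).differentiableAt, ?_⟩
  rw [funext fun η => (hd η).fderiv]
  have hG := continuous_fderiv_translate hk
  refine continuous_iff_continuousAt.2 fun η => ?_
  obtain ⟨C, hC⟩ := exists_bound_ball_of_continuous hG hΩb η
  exact continuousAt_of_dominated (bound := fun _ => C)
    (Filter.Eventually.of_forall fun η =>
      (hG.comp (by fun_prop : Continuous fun ξ : H1 => (η, ξ))).aestronglyMeasurable)
    (Filter.eventually_of_mem (Metric.ball_mem_nhds η one_pos) fun x hx =>
      (ae_restrict_iff' hΩ).2 (Filter.Eventually.of_forall fun ξ hξ => hC x hx ξ hξ))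
    (integrableOn_of_continuous_of_isBounded continuous_const hΩb)
    (Filter.Eventually.of_forall fun ξ =>
      (hG.comp (by fun_prop : Continuous fun η : H1 => (η, ξ))).continuousAt)

lemma fderiv_potential_apply (hΩ : MeasurableSet Ω) (hΩb : Bornology.IsBounded Ω)
    (hk : ContDiff ℝ 1 k) (η v : H1) :
    fderiv ℝ (potential Ω k) η v =
      ∫ ξ in Ω, (fderiv ℝ k (hmul (hinv ξ) η)).comp (hmulLin (hinv ξ)) v := by
  rw [(hasFDerivAt_potential hΩ hΩb hk η).fderiv]
  exact ContinuousLinearMap.integral_apply (integrableOn_of_continuous_of_isBounded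
    ((continuous_fderiv_translate hk).comp (by fun_prop : Continuous fun ξ : H1 => (η, ξ))) hΩb) v

lemma Xd_potential (hΩ : MeasurableSet Ω) (hΩb : Bornology.IsBounded Ω)
    (hk : ContDiff ℝ 1 k) (η : H1) :
    Xd (potential Ω k) η = potential Ω (Xd k) η := by
  simp only [Xd, fderiv_potential_apply hΩ hΩb hk, fderiv_comp_hmulLin_X, potential]

lemma Yd_potential (hΩ : MeasurableSet Ω) (hΩb : Bornology.IsBounded Ω)
    (hk : ContDiff ℝ 1 k) (η : H1) :
    Yd (potential Ω k) η = potential Ω (Yd k) η := by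
  simp only [Yd, fderiv_potential_apply hΩ hΩb hk, fderiv_comp_hmulLin_Y, potential]

end Potential

/-- The first component of the regularised horizontal field with divergence `kernelDiv e`. -/
def kernelX (e : ℝ) (ζ : H1) : ℝ :=
  horizSq ζ * (ζ.1 * horizSq ζ + ζ.2.1 * ζ.2.2) / (π ^ 2 * (gaugePow ζ + e) ^ 2)

/-- The second component of the regularised horizontal field with divergence `kernelDiv e`. -/
def kernelY (e : ℝ) (ζ : H1) : ℝ :=
  horizSq ζ * (ζ.2.1 * horizSq ζ - ζ.1 * ζ.2.2) / (π ^ 2 * (gaugePow ζ + e) ^ 2)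

/-- The horizontal divergence of the field `(kernelX e, kernelY e)`. -/
def kernelDiv (e : ℝ) (ζ : H1) : ℝ :=
  8 / π ^ 2 * (horizSq ζ ^ 2 * e / (gaugePow ζ + e) ^ 3)

lemma kernelDiv_nonneg {e : ℝ} (he : 0 < e) (ζ : H1) : 0 ≤ kernelDiv e ζ := by
  have := gaugePow_nonneg ζ
  unfold kernelDiv; positivity

lemma continuous_kernelDiv {e : ℝ} (he : 0 < e) : Continuous (kernelDiv e) := by
  refine continuous_const.mul (((continuous_horizSq.pow 2).mul continuous_const).div
    ((continuous_gaugePow.add continuous_const).pow 3) fun ζ => ?_)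
  have := gaugePow_nonneg ζ
  positivity

lemma contDiff_kernelX {e : ℝ} (he : 0 < e) : ContDiff ℝ 1 (kernelX e) := by
  have h (ζ : H1) : π ^ 2 * (gaugePow ζ + e) ^ 2 ≠ 0 := by
    have := gaugePow_nonneg ζ
    positivity
  refine ContDiff.div ?_ ?_ h
  · unfold horizSq; fun_prop
  · unfold gaugePow horizSq; fun_prop

lemma contDiff_kernelY {e : ℝ} (he : 0 < e) : ContDiff ℝ 1 (kernelY e) := by
  have h (ζ : H1) : π ^ 2 * (gaugePow ζ + e) ^ 2 ≠ 0 := by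
    have := gaugePow_nonneg ζ
    positivity
  refine ContDiff.div ?_ ?_ h
  · unfold horizSq; fun_prop
  · unfold gaugePow horizSq; fun_prop

lemma fderiv_apply_eq_of_hasDerivAt {u : H1 → ℝ} {η v : H1} (hu : DifferentiableAt ℝ u η) {d : ℝ}
    (h : HasDerivAt (fun s : ℝ => u (η + s • v)) d 0) : fderiv ℝ u η v = d := by
  rw [← hu.lineDeriv_eq_fderiv, lineDeriv, h.deriv]

lemma Xd_kernelX {e : ℝ} (he : 0 < e) (ζ : H1) :
    Xd (kernelX e) ζ = ((2 * ζ.1 * (ζ.1 * horizSq ζ + ζ.2.1 * ζ.2.2) + 3 * horizSq ζ ^ 2) *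
      (gaugePow ζ + e) - 8 * horizSq ζ * (ζ.1 * horizSq ζ + ζ.2.1 * ζ.2.2) ^ 2) /
        (π ^ 2 * (gaugePow ζ + e) ^ 3) := by
  obtain ⟨x, y, t⟩ := ζ
  refine fderiv_apply_eq_of_hasDerivAt
    ((contDiff_kernelX he).differentiable one_ne_zero).differentiableAt ?_
  simp only [kernelX, horizSq, gaugePow, Prod.smul_mk, Prod.mk_add_mk, smul_eq_mul, mul_one,
    mul_zero, add_zero]
  have hpos : 0 < (x ^ 2 + y ^ 2) ^ 2 + t ^ 2 + e := by positivity
  have hx : HasDerivAt (fun s : ℝ => x + s) 1 0 := (hasDerivAt_id (0 : ℝ)).const_add x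
  have ht : HasDerivAt (fun s : ℝ => t + s * (2 * y)) (2 * y) 0 := by
    simpa using ((hasDerivAt_id (0 : ℝ)).mul_const (2 * y)).const_add t
  have hh := (hx.pow 2).add_const (y ^ 2)
  have hq := (((hh.pow 2).add (ht.pow 2)).add_const e)
  have hnum := hh.mul ((hx.mul hh).add (ht.const_mul y))
  refine (hnum.div ((hq.pow 2).const_mul (π ^ 2)) ?_).congr_deriv ?_
  · simp; positivity
  · simp
    field_simp
    ring

lemma Yd_kernelY {e : ℝ} (he : 0 < e) (ζ : H1) :
    Yd (kernelY e) ζ = ((2 * ζ.2.1 * (ζ.2.1 * horizSq ζ - ζ.1 * ζ.2.2) + 3 * horizSq ζ ^ 2) *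
      (gaugePow ζ + e) - 8 * horizSq ζ * (ζ.2.1 * horizSq ζ - ζ.1 * ζ.2.2) ^ 2) /
        (π ^ 2 * (gaugePow ζ + e) ^ 3) := by
  obtain ⟨x, y, t⟩ := ζ
  refine fderiv_apply_eq_of_hasDerivAt
    ((contDiff_kernelY he).differentiable one_ne_zero).differentiableAt ?_
  simp only [kernelY, horizSq, gaugePow, Prod.smul_mk, Prod.mk_add_mk, smul_eq_mul, mul_one,
    mul_zero, add_zero]
  have hpos : 0 < (x ^ 2 + y ^ 2) ^ 2 + t ^ 2 + e := by positivity
  have hy : HasDerivAt (fun s : ℝ => y + s) 1 0 := (hasDerivAt_id (0 : ℝ)).const_add y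
  have ht : HasDerivAt (fun s : ℝ => t + s * (-2 * x)) (-2 * x) 0 := by
    simpa using ((hasDerivAt_id (0 : ℝ)).mul_const (-2 * x)).const_add t
  have hh := (hy.pow 2).const_add (x ^ 2)
  have hq := (((hh.pow 2).add (ht.pow 2)).add_const e)
  have hnum := hh.mul ((hy.mul hh).sub (ht.const_mul x))
  refine (hnum.div ((hq.pow 2).const_mul (π ^ 2)) ?_).congr_deriv ?_
  · simp; positivity
  · simp
    field_simp
    ring

lemma Xd_kernelX_add_Yd_kernelY {e : ℝ} (he : 0 < e) (ζ : H1) :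
    Xd (kernelX e) ζ + Yd (kernelY e) ζ = kernelDiv e ζ := by
  have hpos : 0 < gaugePow ζ + e := add_pos_of_nonneg_of_pos (gaugePow_nonneg ζ) he
  rw [Xd_kernelX he, Yd_kernelY he, kernelDiv]
  field_simp
  simp only [gaugePow, horizSq]
  ring

lemma kernel_sq_le {e : ℝ} (he : 0 < e) (ζ : H1) :
    kernelX e ζ ^ 2 + kernelY e ζ ^ 2 ≤
      (1 / π ^ 2 * (horizSq ζ / gaugePow ζ) ^ (3 / 2 : ℝ)) ^ 2 := by
  have hh := horizSq_nonneg ζ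
  have hN := gaugePow_nonneg ζ
  have hrpow : ((horizSq ζ / gaugePow ζ) ^ (3 / 2 : ℝ)) ^ 2 = (horizSq ζ / gaugePow ζ) ^ 3 := by
    rw [← Real.rpow_natCast, ← Real.rpow_mul (by positivity), ← Real.rpow_natCast]
    norm_num
  have hsq : kernelX e ζ ^ 2 + kernelY e ζ ^ 2 =
      horizSq ζ ^ 3 / π ^ 4 * (gaugePow ζ / (gaugePow ζ + e) ^ 4) := by
    have hpos : 0 < gaugePow ζ + e := by positivity
    rw [kernelX, kernelY]
    field_simp
    simp only [gaugePow, horizSq]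
    ring
  have hle : gaugePow ζ / (gaugePow ζ + e) ^ 4 ≤ (gaugePow ζ ^ 3)⁻¹ := by
    rcases hN.eq_or_lt with h0 | h0
    · simp [← h0]
    · rw [div_le_iff₀ (by positivity), inv_mul_eq_div, le_div_iff₀ (by positivity)]
      calc gaugePow ζ * gaugePow ζ ^ 3 = gaugePow ζ ^ 4 := by ring
        _ ≤ _ := by gcongr; linarith
  rw [mul_pow, hrpow, hsq]
  calc _ ≤ horizSq ζ ^ 3 / π ^ 4 * (gaugePow ζ ^ 3)⁻¹ := by gcongr
    _ = _ := by rw [div_pow]; field_simp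

/-- The potential of the kernel is bounded uniformly in the regularisation. -/
lemma potential_sq_le {Ω : Set H1} (hΩb : Bornology.IsBounded Ω) {s : ℝ} (hs : 0 < s)
    (hvol : volume Ω ≤ ENNReal.ofReal (π ^ 2 / (4 * s ^ 2))) {e : ℝ} (he : 0 < e) (η : H1) :
    potential Ω (kernelX e) η ^ 2 + potential Ω (kernelY e) η ^ 2 ≤ s⁻¹ := by
  set v := potential Ω (kernelX e) η
  set w := potential Ω (kernelY e) η
  set m := √(v ^ 2 + w ^ 2)
  have hτ : Continuous fun ξ : H1 => hmul (hinv ξ) η := by unfold hmul hinv; fun_prop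
  have hcX : Continuous fun ξ => kernelX e (hmul (hinv ξ) η) :=
    (contDiff_kernelX he).continuous.comp hτ
  have hcY : Continuous fun ξ => kernelY e (hmul (hinv ξ) η) :=
    (contDiff_kernelY he).continuous.comp hτ
  let g : H1 → ℝ := fun ξ =>
    √(kernelX e (hmul (hinv ξ) η) ^ 2 + kernelY e (hmul (hinv ξ) η) ^ 2)
  have hg : Continuous g := ((hcX.pow 2).add (hcY.pow 2)).sqrt
  have hgi : ∫ ξ in Ω, g ξ ≤ s ^ (-(1 / 2) : ℝ) := by
    rw [integral_eq_lintegral_of_nonneg_ae (Filter.Eventually.of_forall fun ξ => Real.sqrt_nonneg _)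
      hg.aestronglyMeasurable]
    refine ENNReal.toReal_le_of_le_ofReal (by positivity) ?_
    calc ∫⁻ ξ in Ω, ENNReal.ofReal (g ξ)
        ≤ ∫⁻ ξ in Ω, ENNReal.ofReal (1 / π ^ 2) * ENNReal.ofReal
          ((horizSq (hmul (hinv ξ) η) / gaugePow (hmul (hinv ξ) η)) ^ (3 / 2 : ℝ)) := by
          refine lintegral_mono fun ξ => ?_
          rw [← ENNReal.ofReal_mul (by positivity)]
          refine ENNReal.ofReal_le_ofReal (Real.sqrt_le_iff.2 ⟨?_, kernel_sq_le he _⟩)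
          have := horizSq_nonneg (hmul (hinv ξ) η)
          have := gaugePow_nonneg (hmul (hinv ξ) η)
          positivity
      _ ≤ ENNReal.ofReal (1 / π ^ 2) * ENNReal.ofReal (π ^ 2 * s ^ (-(1 / 2) : ℝ)) := by
          rw [lintegral_const_mul' _ _ ENNReal.ofReal_ne_top]
          gcongr
          exact lintegral_rpow_kernel_le hs hvol η
      _ = ENNReal.ofReal (s ^ (-(1 / 2) : ℝ)) := by
          rw [← ENNReal.ofReal_mul (by positivity)]
          congr 1; field_simp
  have hm : m ^ 2 = v ^ 2 + w ^ 2 := Real.sq_sqrt (by positivity)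
  have hkey : m ^ 2 ≤ m * s ^ (-(1 / 2) : ℝ) := by
    have hiX := integrableOn_of_continuous_of_isBounded hcX hΩb
    have hiY := integrableOn_of_continuous_of_isBounded hcY hΩb
    calc m ^ 2 = ∫ ξ in Ω,
          (v * kernelX e (hmul (hinv ξ) η) + w * kernelY e (hmul (hinv ξ) η)) := by
          rw [integral_add (hiX.const_mul v) (hiY.const_mul w), integral_const_mul,
            integral_const_mul, hm, sq, sq]
          rfl
      _ ≤ ∫ ξ in Ω, m * g ξ := by
          refine integral_mono ((hiX.const_mul v).add (hiY.const_mul w))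
            ((integrableOn_of_continuous_of_isBounded hg hΩb).const_mul m) fun ξ => ?_
          rw [← Real.sqrt_mul (by positivity)]
          refine Real.le_sqrt_of_sq_le ?_
          nlinarith [sq_nonneg (v * kernelY e (hmul (hinv ξ) η) - w * kernelX e (hmul (hinv ξ) η))]
      _ ≤ m * s ^ (-(1 / 2) : ℝ) := by
          rw [integral_const_mul]
          gcongr
  have hm0 : 0 ≤ m := Real.sqrt_nonneg _
  have hms : m ≤ s ^ (-(1 / 2) : ℝ) := by
    rcases hm0.eq_or_lt with h0 | h0
    · rw [← h0]; positivity
    · nlinarith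
  calc v ^ 2 + w ^ 2 = m ^ 2 := hm.symm
    _ ≤ (s ^ (-(1 / 2) : ℝ)) ^ 2 := by gcongr
    _ = s⁻¹ := by
      rw [← Real.rpow_natCast, ← Real.rpow_mul hs.le, ← Real.rpow_neg_one]
      norm_num

lemma kernelDiv_hmul_hinv_comm (e : ℝ) (ξ η : H1) :
    kernelDiv e (hmul (hinv ξ) η) = kernelDiv e (hmul (hinv η) ξ) := by
  simp only [kernelDiv, horizSq_hmul_hinv_comm ξ η, gaugePow_hmul_hinv_comm ξ η]

/-- Testing the perimeter against the potential of the kernel. -/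
lemma lintegral_lintegral_kernelDiv_le {Ω : Set H1} (hΩo : IsOpen Ω)
    (hΩb : Bornology.IsBounded Ω) (hC1 : c1Bdry Ω) {s : ℝ} (hs : 0 < s)
    (hvol : volume Ω ≤ ENNReal.ofReal (π ^ 2 / (4 * s ^ 2))) {e : ℝ} (he : 0 < e) :
    ∫⁻ η in Ω, ∫⁻ ξ in Ω, ENNReal.ofReal (kernelDiv e (hmul (hinv ξ) η))
      ≤ ENNReal.ofReal (horizPerim Ω / √s) := by
  have hm := hΩo.measurableSet
  have hkX := contDiff_kernelX he
  have hkY := contDiff_kernelY he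
  have hpX := contDiff_potential hm hΩb hkX
  have hpY := contDiff_potential hm hΩb hkY
  have hτ (η : H1) : Continuous fun ξ : H1 => hmul (hinv ξ) η := by unfold hmul hinv; fun_prop
  have hdiv (η : H1) : Xd (potential Ω (kernelX e)) η + Yd (potential Ω (kernelY e)) η
      = potential Ω (kernelDiv e) η := by
    rw [Xd_potential hm hΩb hkX, Yd_potential hm hΩb hkY, potential, potential, potential,
      ← funext fun ζ => Xd_kernelX_add_Yd_kernelY he ζ]
    exact (integral_add
      (integrableOn_of_continuous_of_isBounded ((continuous_Xd hkX).comp (hτ η)) hΩb)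
      (integrableOn_of_continuous_of_isBounded ((continuous_Yd hkY).comp (hτ η)) hΩb)).symm
  have hcont : Continuous (potential Ω (kernelDiv e)) := by
    rw [← funext hdiv]
    exact (continuous_Xd hpX).add (continuous_Yd hpY)
  have hnonneg (η : H1) : 0 ≤ potential Ω (kernelDiv e) η :=
    integral_nonneg fun ξ => kernelDiv_nonneg he _
  have hscale : √s * ∫ η in Ω, potential Ω (kernelDiv e) η ≤ horizPerim Ω := by
    refine le_csSup (bddAbove_horizPerim hΩb hC1)
      ⟨fun η => √s * potential Ω (kernelX e) η, fun η => √s * potential Ω (kernelY e) η,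
        contDiff_const.mul hpX, contDiff_const.mul hpY, fun η => ?_, ?_⟩
    · rw [mul_pow, mul_pow, Real.sq_sqrt hs.le, ← mul_add]
      calc _ ≤ s * s⁻¹ := by gcongr; exact potential_sq_le hΩb hs hvol he η
        _ = 1 := mul_inv_cancel₀ hs.ne'
    · rw [← integral_const_mul]
      refine integral_congr_ae (Filter.Eventually.of_forall fun η => ?_)
      simp only [← hdiv, Xd, Yd, mul_add]
      rw [fderiv_const_mul (hpX.differentiable one_ne_zero).differentiableAt,
        fderiv_const_mul (hpY.differentiable one_ne_zero).differentiableAt]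
      rfl
  calc ∫⁻ η in Ω, ∫⁻ ξ in Ω, ENNReal.ofReal (kernelDiv e (hmul (hinv ξ) η))
      = ∫⁻ η in Ω, ENNReal.ofReal (potential Ω (kernelDiv e) η) := by
        refine lintegral_congr fun η => ?_
        exact (ofReal_integral_eq_lintegral_ofReal (integrableOn_of_continuous_of_isBounded
          ((continuous_kernelDiv he).comp (hτ η)) hΩb)
          (Filter.Eventually.of_forall fun ξ => kernelDiv_nonneg he _)).symm
    _ = ENNReal.ofReal (∫ η in Ω, potential Ω (kernelDiv e) η) :=
        (ofReal_integral_eq_lintegral_ofReal (integrableOn_of_continuous_of_isBounded hcont hΩb)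
          (Filter.Eventually.of_forall hnonneg)).symm
    _ ≤ _ := ENNReal.ofReal_le_ofReal
        ((le_div_iff₀' (Real.sqrt_pos.2 hs)).2 hscale)

/-- The kernel of scale `ε ^ 4` averages `Ω` against dilates of `bump`. -/
lemma lintegral_kernelDiv_eq {Ω : Set H1} (hΩ : MeasurableSet Ω) {ε : ℝ} (hε : 0 < ε) (η : H1) :
    ∫⁻ ξ in Ω, ENNReal.ofReal (kernelDiv (ε ^ 4) (hmul (hinv ξ) η)) =
      ∫⁻ ζ, Ω.indicator 1 (hmul η (ε * ζ.1, ε * ζ.2.1, ε ^ 2 * ζ.2.2)) *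
        ENNReal.ofReal (bump ζ) := by
  let F : H1 → ENNReal := Ω.indicator fun ξ =>
    ENNReal.ofReal (kernelDiv (ε ^ 4) (hmul (hinv η) ξ))
  have hτ : Continuous fun ξ : H1 => hmul (hinv η) ξ := by unfold hmul; fun_prop
  have hF : Measurable F :=
    (((continuous_kernelDiv (pow_pos hε 4)).comp hτ).measurable.ennreal_ofReal).indicator hΩ
  simp only [kernelDiv_hmul_hinv_comm _ _ η]
  rw [← lintegral_indicator hΩ]
  refine (lintegral_comp_hmul_dilation hF η hε).symm.trans ?_
  rw [← lintegral_const_mul' _ _ ENNReal.ofReal_ne_top]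
  refine lintegral_congr fun ζ => ?_
  by_cases h : hmul η (ε * ζ.1, ε * ζ.2.1, ε ^ 2 * ζ.2.2) ∈ Ω
  · dsimp only [F]
    rw [indicator_of_mem h, indicator_of_mem h, Pi.one_apply, one_mul,
      ← ENNReal.ofReal_mul (by positivity)]
    congr 1
    have e : hmul (hinv η) (hmul η (ε * ζ.1, ε * ζ.2.1, ε ^ 2 * ζ.2.2)) =
        (ε * ζ.1, ε * ζ.2.1, ε ^ 2 * ζ.2.2) := by
      ext <;> simp [hmul, hinv]; ring
    have hh : horizSq (ε * ζ.1, ε * ζ.2.1, ε ^ 2 * ζ.2.2) = ε ^ 2 * horizSq ζ := by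
      simp only [horizSq]; ring
    have hN : gaugePow (ε * ζ.1, ε * ζ.2.1, ε ^ 2 * ζ.2.2) + ε ^ 4 =
        ε ^ 4 * (gaugePow ζ + 1) := by
      simp only [gaugePow, hh]; ring
    have hpos : 0 < gaugePow ζ + 1 := add_pos_of_nonneg_of_pos (gaugePow_nonneg ζ) one_pos
    rw [e, kernelDiv, bump, hh, hN]
    field_simp
  · dsimp only [F]
    rw [indicator_of_notMem h, indicator_of_notMem h, mul_zero, zero_mul]

lemma one_le_liminf_lintegral_kernelDiv {Ω : Set H1} (hΩo : IsOpen Ω) {η : H1} (hη : η ∈ Ω) :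
    1 ≤ Filter.liminf (fun n : ℕ => ∫⁻ ξ in Ω,
      ENNReal.ofReal (kernelDiv ((1 / ((n : ℝ) + 1)) ^ 4) (hmul (hinv ξ) η))) Filter.atTop := by
  have hε (n : ℕ) : 0 < 1 / ((n : ℝ) + 1) := by positivity
  simp only [lintegral_kernelDiv_eq hΩo.measurableSet (hε _)]
  refine one_le_lintegral_bump.trans (le_trans (le_of_eq (lintegral_congr fun ζ => ?_))
    (lintegral_liminf_le fun n => ?_))
  · have hcont : Continuous fun r : ℝ => hmul η (r * ζ.1, r * ζ.2.1, r ^ 2 * ζ.2.2) := by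
      unfold hmul; fun_prop
    have hlim := (hcont.tendsto 0).comp (tendsto_one_div_add_atTop_nhds_zero_nat (𝕜 := ℝ))
    have h0 : hmul η (0 * ζ.1, 0 * ζ.2.1, 0 ^ 2 * ζ.2.2) = η := by simp [hmul]
    rw [h0] at hlim
    refine (Filter.Tendsto.liminf_eq (tendsto_const_nhds.congr' ?_)).symm
    filter_upwards [hlim.eventually (hΩo.mem_nhds hη)] with n hn
    exact ((congrArg (· * _) (indicator_of_mem hn _)).trans (one_mul _)).symm
  · refine Measurable.mul ((measurable_one.indicator hΩo.measurableSet).comp ?_)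
      continuous_bump.measurable.ennreal_ofReal
    unfold hmul; fun_prop

lemma volume_le_horizPerim_div_sqrt {Ω : Set H1} (hΩo : IsOpen Ω)
    (hΩb : Bornology.IsBounded Ω) (hC1 : c1Bdry Ω) {s : ℝ} (hs : 0 < s)
    (hvol : volume Ω ≤ ENNReal.ofReal (π ^ 2 / (4 * s ^ 2))) :
    volume Ω ≤ ENNReal.ofReal (horizPerim Ω / √s) := by
  have hε (n : ℕ) : 0 < (1 / ((n : ℝ) + 1)) ^ 4 := by positivity
  have hτ : Continuous fun p : H1 × H1 => hmul (hinv p.2) p.1 := by unfold hmul hinv; fun_prop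
  calc volume Ω = ∫⁻ _ in Ω, 1 := (setLIntegral_one Ω).symm
    _ ≤ ∫⁻ η in Ω, Filter.liminf (fun n : ℕ => ∫⁻ ξ in Ω, ENNReal.ofReal
          (kernelDiv ((1 / ((n : ℝ) + 1)) ^ 4) (hmul (hinv ξ) η))) Filter.atTop :=
        setLIntegral_mono' hΩo.measurableSet fun η hη =>
          one_le_liminf_lintegral_kernelDiv hΩo hη
    _ ≤ Filter.liminf (fun n : ℕ => ∫⁻ η in Ω, ∫⁻ ξ in Ω, ENNReal.ofReal
          (kernelDiv ((1 / ((n : ℝ) + 1)) ^ 4) (hmul (hinv ξ) η))) Filter.atTop :=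
        lintegral_liminf_le fun n =>
          ((continuous_kernelDiv (hε n)).comp hτ).measurable.ennreal_ofReal.lintegral_prod_right'
    _ ≤ _ := Filter.liminf_le_of_le (by isBoundedDefault) fun b hb => by
        obtain ⟨n, hn⟩ := hb.exists
        exact hn.trans (lintegral_lintegral_kernelDiv_le hΩo hΩb hC1 hs hvol (hε n))

lemma horizPerim_nonneg {Ω : Set H1} (hΩb : Bornology.IsBounded Ω) (hC1 : c1Bdry Ω) :
    0 ≤ horizPerim Ω :=
  le_csSup (bddAbove_horizPerim hΩb hC1)
    ⟨fun _ => 0, fun _ => 0, contDiff_const, contDiff_const, fun _ => by norm_num,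
      by simp [Xd, Yd]⟩

lemma sqrt_two_div_pi_le : √(2 / π) ≤ (3 / (2 * π)) ^ ((1 : ℝ) / 4) := by
  have h : √(2 / π) = ((2 / π) ^ 2) ^ ((1 : ℝ) / 4) := by
    rw [Real.sqrt_eq_rpow, ← Real.rpow_natCast, ← Real.rpow_mul (by positivity)]
    norm_num
  rw [h]
  refine Real.rpow_le_rpow (by positivity) ?_ (by norm_num)
  rw [div_pow, div_le_div_iff₀ (by positivity) (by positivity)]
  nlinarith [pi_gt_three]

/-- Pansu's isoperimetric inequality:
|Ω|^{3/4} ≤ (3/(2π))^{1/4}·P_ℍ(Ω) for a bounded open set Ω with C¹ boundary. -/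
theorem pansu_isoperimetric (Ω : Set H1) (hΩo : IsOpen Ω)
    (hΩb : Bornology.IsBounded Ω) (hC1 : c1Bdry Ω) :
    (volume Ω).toReal ^ ((3 : ℝ) / 4) ≤ (3 / (2 * π)) ^ ((1 : ℝ) / 4) * horizPerim Ω := by
  have hP := horizPerim_nonneg hΩb hC1
  obtain ⟨a, ha⟩ : ∃ a, a = (volume Ω).toReal := ⟨_, rfl⟩
  have ha0 : 0 ≤ a := ha ▸ ENNReal.toReal_nonneg
  rw [← ha]
  rcases ha0.eq_or_lt with h0 | h0
  · rw [← h0, Real.zero_rpow (by norm_num)]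
    positivity
  have hvol : volume Ω = ENNReal.ofReal a := by
    rw [ha, ENNReal.ofReal_toReal hΩb.measure_lt_top.ne]
  have hs : 0 < π / (2 * √a) := by positivity
  have hle := volume_le_horizPerim_div_sqrt hΩo hΩb hC1 hs (by
    rw [hvol, div_pow, mul_pow, Real.sq_sqrt h0.le]
    refine ENNReal.ofReal_le_ofReal (le_of_eq ?_)
    field_simp; norm_num)
  rw [hvol, ENNReal.ofReal_le_ofReal_iff (by positivity)] at hle
  have hroot : √(π / (2 * √a)) = a ^ (-(1 / 4) : ℝ) / √(2 / π) := by
    have e : π / (2 * √a) = a ^ (-(1 / 2) : ℝ) / (2 / π) := by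
      rw [Real.rpow_neg h0.le, ← Real.sqrt_eq_rpow]; field_simp
    rw [e, Real.sqrt_div (by positivity), Real.sqrt_eq_rpow, ← Real.rpow_mul h0.le]
    norm_num
  have hpos : 0 < √(2 / π) := by positivity
  rw [hroot, le_div_iff₀ (by positivity), ← mul_div_assoc, div_le_iff₀ hpos] at hle
  calc a ^ ((3 : ℝ) / 4) = a * a ^ (-(1 / 4) : ℝ) := by
        rw [← Real.rpow_one_add' h0.le (by norm_num)]; norm_num
    _ ≤ √(2 / π) * horizPerim Ω := by rwa [mul_comm (√(2 / π))]
    _ ≤ _ := mul_le_mul_of_nonneg_right sqrt_two_div_pi_le hP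
end
end

section
/- Let R > 0, l > 0, and define u(η) = (1/ρ(η)) · J₁(l·ρ(η)/R) for η ∈ ℝ³ ∖ {0}. Then u satisfies −Δ_ℍ u(η) = (l²/R²) · ψ(η) · u(η) for every η ∈ B(0,R) ∖ {0}, where ψ(x,y,t) = (x²+y²)/ρ(x,y,t)². Moreover, if J₁(l) = 0, then u(η) = 0 for every η with ρ(η) = R. -/
open MeasureTheory Real Set

noncomputable section

/-- The entire function `∑ (-1)^k s^k / (k! (k+n)!)`. Up to scaling, `(l/2)^n * besselAux n (l²/4)`
is the Bessel function of order `n`. -/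
def besselAux (n : ℕ) (s : ℝ) : ℝ :=
  ∑' k : ℕ, ((-1 : ℝ) ^ k / ((Nat.factorial k : ℝ) * (Nat.factorial (k + n) : ℝ))) * s ^ k

lemma norm_besselAux_coeff_le (n k : ℕ) :
    ‖(-1 : ℝ) ^ k / ((Nat.factorial k : ℝ) * (Nat.factorial (k + n) : ℝ))‖ ≤
      1 / (Nat.factorial k : ℝ) := by
  have h1 : (0 : ℝ) < Nat.factorial k := by positivity
  have h2 : (1 : ℝ) ≤ Nat.factorial (k + n) := by
    exact_mod_cast Nat.factorial_pos (k + n)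
  rw [norm_div, norm_pow, norm_neg, norm_one, one_pow, Real.norm_of_nonneg (by positivity)]
  apply one_div_le_one_div_of_le h1
  nlinarith

lemma summable_besselAux (n : ℕ) (s : ℝ) :
    Summable fun k : ℕ =>
      ((-1 : ℝ) ^ k / ((Nat.factorial k : ℝ) * (Nat.factorial (k + n) : ℝ))) * s ^ k := by
  refine Summable.of_norm_bounded (Real.summable_pow_div_factorial |s|) fun k => ?_
  rw [norm_mul, norm_pow, Real.norm_eq_abs s, div_eq_mul_one_div (|s| ^ k), mul_comm]
  exact mul_le_mul_of_nonneg_left (norm_besselAux_coeff_le n k) (by positivity)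

lemma hasDerivAt_besselAux (n : ℕ) (s : ℝ) :
    HasDerivAt (besselAux n) (-besselAux (n + 1) s) s := by
  set r : ℝ := |s| + 1
  have hr : 0 < r := by positivity
  have hs : s ∈ Metric.ball (0 : ℝ) r := by
    simp [r]
  have hbound : Summable fun k : ℕ => (1 / (Nat.factorial k : ℝ)) * (k * r ^ (k - 1)) := by
    rw [← summable_nat_add_iff 1]
    refine (Real.summable_pow_div_factorial r).congr fun k => ?_
    rw [Nat.factorial_succ]
    push_cast
    field_simp
  have key := hasDerivAt_tsum_of_isPreconnected
    (g := fun (k : ℕ) (x : ℝ) =>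
      ((-1 : ℝ) ^ k / ((Nat.factorial k : ℝ) * (Nat.factorial (k + n) : ℝ))) * x ^ k)
    (g' := fun (k : ℕ) (x : ℝ) =>
      ((-1 : ℝ) ^ k / ((Nat.factorial k : ℝ) * (Nat.factorial (k + n) : ℝ))) *
        (k * x ^ (k - 1)))
    hbound Metric.isOpen_ball (convex_ball (0 : ℝ) r).isPreconnected
    (fun k x _ => (hasDerivAt_pow k x).const_mul _)
    (fun k x hx => by
      rw [norm_mul]
      refine mul_le_mul (norm_besselAux_coeff_le n k) ?_ (norm_nonneg _) (by positivity)
      rw [norm_mul, norm_pow, Real.norm_natCast]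
      have : ‖x‖ ≤ r := by simpa using (mem_ball_zero_iff.1 hx).le
      gcongr)
    hs (summable_besselAux n s) hs
  have hsum : Summable fun k : ℕ =>
      ((-1 : ℝ) ^ k / ((Nat.factorial k : ℝ) * (Nat.factorial (k + n) : ℝ))) *
        (k * s ^ (k - 1)) := by
    rw [← summable_nat_add_iff 1]
    refine (summable_besselAux (n + 1) s).neg.congr fun k => ?_
    rw [Nat.factorial_succ k, show k + 1 + n = k + (n + 1) by ring]
    push_cast
    field_simp
    simp [pow_succ, mul_comm]
  refine key.congr_deriv ?_
  rw [hsum.tsum_eq_zero_add, besselAux, ← tsum_neg]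
  simp only [Nat.cast_zero, zero_mul, mul_zero, zero_add]
  refine tsum_congr fun k => ?_
  rw [Nat.factorial_succ k, show k + 1 + n = k + (n + 1) by ring]
  push_cast
  field_simp
  simp [pow_succ, mul_comm]

/-- The three-term recurrence between consecutive orders. -/
lemma besselAux_recurrence (n : ℕ) (s : ℝ) :
    s * besselAux (n + 2) s - (n + 1) * besselAux (n + 1) s + besselAux n s = 0 := by
  have h0 := (summable_besselAux n s).tsum_eq_zero_add
  have h1 := (summable_besselAux (n + 1) s).tsum_eq_zero_add
  have hn := (summable_nat_add_iff 1).2 (summable_besselAux n s)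
  have hn1 := (summable_nat_add_iff 1).2 (summable_besselAux (n + 1) s)
  have htail : s * besselAux (n + 2) s =
      (n + 1) * (∑' k : ℕ, ((-1 : ℝ) ^ (k + 1) /
        ((Nat.factorial (k + 1) : ℝ) * (Nat.factorial (k + 1 + (n + 1)) : ℝ))) * s ^ (k + 1)) -
      ∑' k : ℕ, ((-1 : ℝ) ^ (k + 1) /
        ((Nat.factorial (k + 1) : ℝ) * (Nat.factorial (k + 1 + n) : ℝ))) * s ^ (k + 1) := by
    rw [besselAux, ← tsum_mul_left, ← tsum_mul_left, ← (hn1.mul_left _).tsum_sub hn]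
    refine tsum_congr fun k => ?_
    rw [show k + 1 + (n + 1) = (k + n + 1) + 1 by ring, show k + 1 + n = k + n + 1 by ring,
      show k + (n + 2) = (k + n + 1) + 1 by ring, Nat.factorial_succ (k + n + 1),
      Nat.factorial_succ k]
    push_cast
    field_simp
    ring
  rw [htail, besselAux, besselAux, h0, h1]
  simp only [zero_add, Nat.factorial_succ n, pow_zero, Nat.factorial_zero]
  push_cast
  field_simp
  ring

lemma J1_eq (l : ℝ) : J1 l = l / 2 * besselAux 1 ((l / 2) ^ 2) := by
  simp only [J1, besselAux, pow_mul]

/-- The fourth power of the Koranyi norm. -/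
def koranyiGauge (η : H1) : ℝ := (η.1 ^ 2 + η.2.1 ^ 2) ^ 2 + η.2.2 ^ 2

lemma differentiable_koranyiGauge : Differentiable ℝ koranyiGauge := by
  unfold koranyiGauge; fun_prop

lemma koranyiGauge_pos {η : H1} (hη : η ≠ 0) : 0 < koranyiGauge η := by
  obtain ⟨x, y, t⟩ := η
  have h0 : 0 ≤ koranyiGauge (x, y, t) := by unfold koranyiGauge; positivity
  refine h0.lt_of_ne fun h => hη ?_
  simp only [koranyiGauge] at h
  have ht : t = 0 := by nlinarith [sq_nonneg (x ^ 2 + y ^ 2), sq_nonneg t]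
  have hz : x ^ 2 + y ^ 2 = 0 := by nlinarith [sq_nonneg (x ^ 2 + y ^ 2), sq_nonneg t]
  have hx : x = 0 := by nlinarith [sq_nonneg x, sq_nonneg y]
  have hy : y = 0 := by nlinarith [sq_nonneg x, sq_nonneg y]
  simp [hx, hy, ht]

lemma ρH_sq (η : H1) : ρH η ^ 2 = √(koranyiGauge η) := by
  have h0 : 0 ≤ koranyiGauge η := by unfold koranyiGauge; positivity
  rw [ρH, ← koranyiGauge, ← Real.rpow_natCast, ← Real.rpow_mul h0, Real.sqrt_eq_rpow]
  norm_num

lemma ρH_pos {η : H1} (hη : η ≠ 0) : 0 < ρH η :=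
  Real.rpow_pos_of_pos (koranyiGauge_pos hη) _

lemma fderiv_koranyiGauge (η v : H1) :
    fderiv ℝ koranyiGauge η v =
      4 * (η.1 ^ 2 + η.2.1 ^ 2) * (η.1 * v.1 + η.2.1 * v.2.1) + 2 * η.2.2 * v.2.2 := by
  have h1 : HasFDerivAt (𝕜 := ℝ) (fun ξ : H1 => ξ.1) _ η := hasFDerivAt_fst
  have h2 : HasFDerivAt (𝕜 := ℝ) (fun ξ : H1 => ξ.2) _ η := hasFDerivAt_snd
  have h : HasFDerivAt koranyiGauge _ η :=
    ((((h1.pow 2).add (h2.fst.pow 2)).pow 2).add (h2.snd.pow 2))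
  rw [h.fderiv]
  simp
  ring

lemma Xd_koranyiGauge :
    Xd koranyiGauge =
      fun η => 4 * (η.1 ^ 2 + η.2.1 ^ 2) * η.1 + 4 * (η.2.1 * η.2.2) := by
  funext η
  rw [Xd, fderiv_koranyiGauge]
  ring

lemma Yd_koranyiGauge :
    Yd koranyiGauge =
      fun η => 4 * (η.1 ^ 2 + η.2.1 ^ 2) * η.2.1 - 4 * (η.1 * η.2.2) := by
  funext η
  rw [Yd, fderiv_koranyiGauge]
  ring

lemma kohn_koranyiGauge (η : H1) :
    kohn koranyiGauge η = 24 * (η.1 ^ 2 + η.2.1 ^ 2) := by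
  have h1 : HasFDerivAt (𝕜 := ℝ) (fun ξ : H1 => ξ.1) _ η := hasFDerivAt_fst
  have h2 : HasFDerivAt (𝕜 := ℝ) (fun ξ : H1 => ξ.2) _ η := hasFDerivAt_snd
  have hX : HasFDerivAt (𝕜 := ℝ)
      (fun η : H1 => 4 * (η.1 ^ 2 + η.2.1 ^ 2) * η.1 + 4 * (η.2.1 * η.2.2)) _ η :=
    ((((h1.pow 2).add (h2.fst.pow 2)).const_mul 4).mul h1).add
      ((h2.fst.mul h2.snd).const_mul 4)
  have hY : HasFDerivAt (𝕜 := ℝ)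
      (fun η : H1 => 4 * (η.1 ^ 2 + η.2.1 ^ 2) * η.2.1 - 4 * (η.1 * η.2.2)) _ η :=
    ((((h1.pow 2).add (h2.fst.pow 2)).const_mul 4).mul h2.fst).sub
      ((h1.mul h2.snd).const_mul 4)
  rw [kohn, Xd_koranyiGauge, Yd_koranyiGauge, Xd, Yd, hX.fderiv, hY.fderiv]
  simp
  ring

lemma kohn_congr {u v : H1 → ℝ} {η : H1} (h : u =ᶠ[nhds η] v) : kohn u η = kohn v η := by
  have hX : Xd u =ᶠ[nhds η] Xd v := (h.fderiv (𝕜 := ℝ)).mono fun ξ hξ => by simp only [Xd, hξ]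
  have hY : Yd u =ᶠ[nhds η] Yd v := (h.fderiv (𝕜 := ℝ)).mono fun ξ hξ => by simp only [Yd, hξ]
  rw [kohn, kohn, Xd, Yd, hX.fderiv_eq, hY.fderiv_eq, ← Xd, ← Yd]

/-- Chain rule for the Kohn-Laplacian. -/
lemma kohn_comp {g g' : ℝ → ℝ} {g'' : ℝ} {f : H1 → ℝ} {η : H1}
    (hf : Differentiable ℝ f) (hX : DifferentiableAt ℝ (Xd f) η)
    (hY : DifferentiableAt ℝ (Yd f) η)
    (hg : ∀ᶠ ξ in nhds η, HasDerivAt g (g' (f ξ)) (f ξ)) (hg' : HasDerivAt g' g'' (f η)) :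
    kohn (fun ξ => g (f ξ)) η = g'' * (Xd f η ^ 2 + Yd f η ^ 2) + g' (f η) * kohn f η := by
  have hfd : ∀ᶠ ξ in nhds η,
      fderiv ℝ (fun ξ => g (f ξ)) ξ = g' (f ξ) • fderiv ℝ f ξ :=
    hg.mono fun ξ hξ => (hξ.comp_hasFDerivAt ξ (hf ξ).hasFDerivAt).fderiv
  have eX : Xd (fun ξ => g (f ξ)) =ᶠ[nhds η] fun ξ => g' (f ξ) * Xd f ξ :=
    hfd.mono fun ξ hξ => by simp [Xd, hξ]
  have eY : Yd (fun ξ => g (f ξ)) =ᶠ[nhds η] fun ξ => g' (f ξ) * Yd f ξ :=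
    hfd.mono fun ξ hξ => by simp [Yd, hξ]
  have hc : HasFDerivAt (fun ξ => g' (f ξ)) _ η := hg'.comp_hasFDerivAt η (hf η).hasFDerivAt
  rw [kohn, Xd, Yd, eX.fderiv_eq, eY.fderiv_eq, fderiv_fun_mul hc.differentiableAt hX,
    fderiv_fun_mul hc.differentiableAt hY, hc.fderiv]
  simp only [kohn, Xd, Yd, add_apply, smul_apply,
    smul_eq_mul]
  ring

/-- The Kohn-Laplacian of a function of the Koranyi gauge. -/
lemma kohn_comp_koranyiGauge {g g' : ℝ → ℝ} {g'' : ℝ} {η : H1} (hη : η ≠ 0)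
    (hg : ∀ s, 0 < s → HasDerivAt g (g' s) s) (hg' : HasDerivAt g' g'' (koranyiGauge η)) :
    kohn (fun ξ => g (koranyiGauge ξ)) η = 8 * (η.1 ^ 2 + η.2.1 ^ 2) *
      (2 * koranyiGauge η * g'' + 3 * g' (koranyiGauge η)) := by
  rw [kohn_comp differentiable_koranyiGauge (by rw [Xd_koranyiGauge]; fun_prop)
    (by rw [Yd_koranyiGauge]; fun_prop)
    ((isOpen_ne.mem_nhds hη : {ξ : H1 | ξ ≠ 0} ∈ nhds η) |> Filter.mem_of_superset <|
      fun ξ hξ => hg _ (koranyiGauge_pos hξ)) hg',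
    kohn_koranyiGauge, Xd_koranyiGauge, Yd_koranyiGauge]
  simp only [koranyiGauge]
  ring

/-- u(η) = (1/ρ(η))·J₁(l·ρ(η)/R) satisfies
−Δ_ℍ u = (l²/R²)·ψ·u on B(0,R) ∖ {0}, with ψ = (x²+y²)/ρ², and u vanishes on
{ρ = R} when J₁(l) = 0. -/
theorem bessel_radial_eigenfunction (R l : ℝ) (hR : 0 < R) (hl : 0 < l) :
    let u : H1 → ℝ := fun η => (1 / ρH η) * J1 (l * ρH η / R)
    (∀ η : H1, ρH η < R → η ≠ 0 →
      -(kohn u η) = l ^ 2 / R ^ 2 * ((η.1 ^ 2 + η.2.1 ^ 2) / ρH η ^ 2) * u η) ∧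
    (J1 l = 0 → ∀ η : H1, ρH η = R → u η = 0) := by
  intro u
  refine ⟨fun η _ hη => ?_, fun h η hη => ?_⟩
  · set c : ℝ := l / R with hc
    have hu : ∀ ξ : H1, ξ ≠ 0 →
        u ξ = c / 2 * besselAux 1 (c ^ 2 / 4 * √(koranyiGauge ξ)) := by
      intro ξ hξ
      have hρ := ρH_pos hξ
      simp only [u]
      rw [J1_eq, ← ρH_sq, show (l * ρH ξ / R / 2) ^ 2 = c ^ 2 / 4 * ρH ξ ^ 2 by
        rw [hc]; ring, hc]
      field_simp
    have hev : u =ᶠ[nhds η]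
        fun ξ => c / 2 * besselAux 1 (c ^ 2 / 4 * √(koranyiGauge ξ)) :=
      Filter.mem_of_superset (isOpen_ne.mem_nhds hη) hu
    have hs : ∀ s : ℝ, 0 < s →
        HasDerivAt (fun s => c ^ 2 / 4 * √s) (c ^ 2 / 4 * (1 / (2 * √s))) s :=
      fun s hs => (Real.hasDerivAt_sqrt hs.ne').const_mul _
    have hpos := koranyiGauge_pos hη
    have hw : 0 < √(koranyiGauge η) := Real.sqrt_pos.2 hpos
    have hg' := ((((hasDerivAt_besselAux 2 _).comp _ (hs _ hpos)).neg.mul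
      (((Real.hasDerivAt_sqrt hpos.ne').const_mul 2).inv (by positivity))).const_mul
        (c / 2 * (c ^ 2 / 4)))
    have hk := kohn_comp_koranyiGauge (g := fun s => c / 2 * besselAux 1 (c ^ 2 / 4 * √s))
      (g' := fun s => c / 2 * (c ^ 2 / 4) * (-besselAux 2 (c ^ 2 / 4 * √s) * (2 * √s)⁻¹)) hη
      (fun s h0 => by
        refine (((hasDerivAt_besselAux 1 _).comp s (hs s h0)).const_mul (c / 2)).congr_deriv ?_
        ring)
      hg'
    have hrec := besselAux_recurrence 1 (c ^ 2 / 4 * √(koranyiGauge η))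
    have hsq : koranyiGauge η = √(koranyiGauge η) ^ 2 := (Real.sq_sqrt hpos.le).symm
    rw [kohn_congr hev, hk, hu η hη, ρH_sq, ← div_pow, ← hc]
    simp only [Function.comp_apply, Pi.neg_apply, Pi.inv_apply] at hrec ⊢
    norm_num at hrec ⊢
    generalize √(koranyiGauge η) = w at *
    rw [hsq]
    generalize besselAux 1 (c ^ 2 / 4 * w) = a1 at *
    generalize besselAux 2 (c ^ 2 / 4 * w) = a2 at *
    generalize besselAux 3 (c ^ 2 / 4 * w) = a3 at *
    have ha : a1 = 2 * a2 - c ^ 2 / 4 * w * a3 := by linarith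
    rw [ha]
    field_simp
    ring
  · simp only [u]
    rw [hη, mul_div_assoc, div_self hR.ne', mul_one, h, mul_zero]
end
end
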